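/- (i) The family {P_θ(m)φ̃ : m ∈ M_θ} is a basis of the K-vector space Ṽ_θ(0); equivalently, the natural surjection of U_q^-(gl_∞)-modules Ṽ_θ(0) = U_q^-(gl_∞)/Σ_k U_q^-(gl_∞)(f_k − f_{−k}) → V_θ(0) sending φ̃ to φ is an isomorphism. (ii) Ṽ_θ(0) is an irreducible B_θ(gl_∞)-module and {u ∈ Ṽ_θ(0) : E_i u = 0 for all i ∈ I} = K·φ̃. -/

import Mathlib

/-! `K = ℚ(q)` and the algebra `B_θ(gl_∞)`. -/

noncomputable section

/-- The base field `K = ℚ(q)`. -/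
abbrev K : Type := RatFunc ℚ

/-- The indeterminate `q`. -/
def q : K := RatFunc.X

/-- The `q`-integer `[n]`. -/
def qint (n : ℤ) : K := (q ^ n - q ^ (-n)) / (q - q⁻¹)

/-- The `q`-factorial `[n]!`. -/
def qfact (n : ℕ) : K := ∏ k ∈ Finset.range n, qint (k + 1)

/-- Generators of `B_θ(gl_∞)`: `E_i`, `F_i`, `T_i`, `T_i⁻¹`; the parameter `a : ℤ`
encodes the odd integer `i = 2a+1`. -/
inductive BGen : Type
  | E : ℤ → BGen
  | F : ℤ → BGen
  | T : ℤ → BGen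
  | Tinv : ℤ → BGen

/-- Generators inside the free algebra. -/
def g (x : BGen) : FreeAlgebra K BGen := FreeAlgebra.ι K x

/-- The symmetric form `(α_i, α_j)` on the simple roots of `gl_∞`:
`2` if `i = j`, `−1` if `|i − j| = 2`, `0` otherwise. -/
def ip (i j : ℤ) : ℤ := if i = j then 2 else if (i - j).natAbs = 2 then -1 else 0

/-- The defining relations of `B_θ(gl_∞)` (with `θ(i) = −i`): the `T_i` commute and are
invertible, `T_{−i} = T_i`, `T_i E_j T_i⁻¹ = q^{(α_i+α_{−i},α_j)} E_j`,
`T_i F_j T_i⁻¹ = q^{−(α_i+α_{−i},α_j)} F_j`,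
`E_i F_j = q^{−(α_i,α_j)} F_j E_i + δ_{i,j} + δ_{−i,j} T_i`, and the `q`-Serre relations
for the `E_i`'s and for the `F_i`'s.  The parameter `a : ℤ` encodes `i = 2a+1`, so that
`θ` corresponds to `a ↦ −a−1`, `|i−j| > 2 ↔ 1 < |a−b|` and `|i−j| = 2 ↔ |a−b| = 1`. -/
inductive BRel : FreeAlgebra K BGen → FreeAlgebra K BGen → Prop
  | Tcomm (a b : ℤ) : BRel (g (.T a) * g (.T b)) (g (.T b) * g (.T a))
  | TTinv (a : ℤ) : BRel (g (.T a) * g (.Tinv a)) 1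
  | TinvT (a : ℤ) : BRel (g (.Tinv a) * g (.T a)) 1
  | Ttheta (a : ℤ) : BRel (g (.T (-a - 1))) (g (.T a))
  | TE (a b : ℤ) : BRel (g (.T a) * g (.E b) * g (.Tinv a))
      (q ^ (ip (2*a+1) (2*b+1) + ip (-(2*a+1)) (2*b+1)) • g (.E b))
  | TF (a b : ℤ) : BRel (g (.T a) * g (.F b) * g (.Tinv a))
      (q ^ (-(ip (2*a+1) (2*b+1) + ip (-(2*a+1)) (2*b+1))) • g (.F b))
  | EF (a b : ℤ) : BRel (g (.E a) * g (.F b))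
      (q ^ (-(ip (2*a+1) (2*b+1))) • (g (.F b) * g (.E a))
        + (if a = b then 1 else 0) + (if -a - 1 = b then g (.T a) else 0))
  | Efar (a b : ℤ) (h : 1 < |a - b|) : BRel (g (.E a) * g (.E b)) (g (.E b) * g (.E a))
  | Eserre (a b : ℤ) (h : |a - b| = 1) :
      BRel (g (.E a) * g (.E a) * g (.E b) + g (.E b) * (g (.E a) * g (.E a)))
           ((q + q⁻¹) • (g (.E a) * g (.E b) * g (.E a)))
  | Ffar (a b : ℤ) (h : 1 < |a - b|) : BRel (g (.F a) * g (.F b)) (g (.F b) * g (.F a))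
  | Fserre (a b : ℤ) (h : |a - b| = 1) :
      BRel (g (.F a) * g (.F a) * g (.F b) + g (.F b) * (g (.F a) * g (.F a)))
           ((q + q⁻¹) • (g (.F a) * g (.F b) * g (.F a)))

/-- The algebra `B_θ(gl_∞)`. -/
abbrev U : Type := RingQuot BRel

/-- The generator `E_i` for an odd integer `i`. -/
def Ee (i : ℤ) : U := RingQuot.mkAlgHom K BRel (g (.E ((i - 1) / 2)))

/-- The generator `F_i` for an odd integer `i`; this is also the image of
`f_i ∈ U_q^-(gl_∞)` under `f_i ↦ F_i`. -/
def fgen (i : ℤ) : U := RingQuot.mkAlgHom K BRel (g (.F ((i - 1) / 2)))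

/-- The generator `T_i` for an odd integer `i`. -/
def Tt (i : ℤ) : U := RingQuot.mkAlgHom K BRel (g (.T ((i - 1) / 2)))

/-- `segAux i n` is the segment `⟨i, i+2n⟩` (built from the `F` generators). -/
def segAux (i : ℤ) : ℕ → U
  | 0 => fgen i
  | n + 1 => segAux i n * fgen (i + 2 * (n + 1)) - q • (fgen (i + 2 * (n + 1)) * segAux i n)

/-- The segment `⟨i,j⟩` for odd `i ≤ j`. -/
def seg (i j : ℤ) : U := segAux i ((j - i) / 2).toNat

/-- The divided power `⟨i,j⟩^{(n)}` (zero for `n < 0`). -/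
def segPow (i j : ℤ) (n : ℤ) : U :=
  if n < 0 then 0 else (qfact n.toNat)⁻¹ • seg i j ^ n.toNat

/-- The modified divided power `⟨i,j⟩^{[n]}`. -/
def segPowM (i j : ℤ) (n : ℤ) : U :=
  if i = -j then
    (if n < 0 then 0 else (∏ ν ∈ Finset.range n.toNat, qint (2 * (ν + 1)))⁻¹ • seg i j ^ n.toNat)
  else segPow i j n


open scoped Classical

/-- Multisegments as elements of the free abelian group on the segments `⟨i,j⟩`. -/
abbrev MS : Type := (ℤ × ℤ) →₀ ℤ

/-- The segment `⟨i,j⟩` viewed as a multisegment. -/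
def sg (i j : ℤ) : MS := Finsupp.single (i, j) 1

/-- `m` is a multisegment: supported on pairs of odd integers `i ≤ j`,
with nonnegative multiplicities. -/
def IsMulti (m : MS) : Prop :=
  ∀ i j : ℤ, m (i, j) ≠ 0 → Odd i ∧ Odd j ∧ i ≤ j ∧ 0 < m (i, j)

/-- `m` is a θ-restricted multisegment (`m_{i,j} = 0` unless `−j ≤ i ≤ j`). -/
def IsTheta (m : MS) : Prop :=
  ∀ i j : ℤ, m (i, j) ≠ 0 → Odd i ∧ Odd j ∧ -j ≤ i ∧ i ≤ j ∧ 0 < m (i, j)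

/-- The pairs `(i,j)` in the box `[-N,N]²`, listed in decreasing PBW order,
i.e. decreasing lexicographic order in `(j,i)`. -/
def box (N : ℕ) : List (ℤ × ℤ) :=
  (List.range (2 * N + 1)).flatMap fun a =>
    (List.range (2 * N + 1)).map fun b => (((N : ℤ) - b, (N : ℤ) - a))

/-- A bound on the support of `m`. -/
def bound (m : MS) : ℕ := m.support.sup fun p => max p.1.natAbs p.2.natAbs

/-- The product of the modified divided powers `⟨i,j⟩^{[m_{i,j}]}` over the segments
appearing in `m`, in decreasing PBW order. -/
def PthetaProd (m : MS) : U := ((box (bound m)).map fun p => segPowM p.1 p.2 (m p)).prod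

/-- `P_θ(m)` for a θ-restricted multisegment `m`; it is `0` if `m` is not a
θ-restricted multisegment. -/
def Ptheta (m : MS) : U := if IsTheta m then PthetaProd m else 0

/-- The left ideal `Σ_i (B_θ(gl_∞)E_i + B_θ(gl_∞)(T_i − 1) + B_θ(gl_∞)(F_i − F_{−i}))`
(over odd `i`). -/
def Jideal : Ideal U := Ideal.span
  {x : U | ∃ i : ℤ, Odd i ∧ (x = Ee i ∨ x = Tt i - 1 ∨ x = fgen i - fgen (-i))}

/-- The `B_θ(gl_∞)`-module `Ṽ_θ(0)`. -/
abbrev Vt : Type := U ⧸ Jideal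

/-- The generator `φ̃ ∈ Ṽ_θ(0)`, image of `1`. -/
def phi : Vt := Submodule.Quotient.mk 1

namespace BTheta

instance (priority := 2000) natAlgebraK : Algebra ℕ K := Semiring.toNatAlgebra

instance (priority := 2000) intAlgebraK : Algebra ℤ K := Ring.toIntAlgebra _

/-- The generator `F_i` with `i = 2a+1`. -/
def ff (a : ℤ) : U := RingQuot.mkAlgHom K BRel (g (.F a))

/-- The generator `E_i` with `i = 2a+1`. -/
def ee (a : ℤ) : U := RingQuot.mkAlgHom K BRel (g (.E a))

/-- The generator `T_i` with `i = 2a+1`. -/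
def tt (a : ℤ) : U := RingQuot.mkAlgHom K BRel (g (.T a))

/-- The generator `T_i⁻¹` with `i = 2a+1`. -/
def ti (a : ℤ) : U := RingQuot.mkAlgHom K BRel (g (.Tinv a))

/-- The form `(α_i, α_j)` with `i = 2a+1`, `j = 2b+1`. -/
def cf (a b : ℤ) : ℤ := ip (2 * a + 1) (2 * b + 1)

lemma cf_def (a b : ℤ) :
    cf a b = if a = b then 2 else if a = b + 1 ∨ b = a + 1 then -1 else 0 := by
  unfold cf ip
  split_ifs <;> omega

lemma cf_neg (a b : ℤ) : ip (-(2 * a + 1)) (2 * b + 1) = cf (-a - 1) b := by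
  unfold cf; congr 1; ring

lemma cf_self (a : ℤ) : cf a a = 2 := by simp [cf_def]

lemma cf_symm (a b : ℤ) : cf a b = cf b a := by
  rw [cf_def, cf_def]; split_ifs <;> omega

lemma cf_adj {a b : ℤ} (h : a = b + 1 ∨ b = a + 1) : cf a b = -1 := by
  rw [cf_def]; split_ifs <;> omega

lemma cf_far {a b : ℤ} (h : a + 1 < b ∨ b + 1 < a) : cf a b = 0 := by
  rw [cf_def]; split_ifs <;> omega

lemma cf_theta (a b : ℤ) : cf (-a - 1) (-b - 1) = cf a b := by
  rw [cf_def, cf_def]; split_ifs <;> omega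

lemma q_ne : q ≠ 0 := RatFunc.X_ne_zero

lemma q_zpow_ne (n : ℤ) : q ^ n ≠ 0 := zpow_ne_zero _ q_ne

lemma tt_mul_ti (a : ℤ) : tt a * ti a = 1 := by
  have := RingQuot.mkAlgHom_rel K (BRel.TTinv a)
  simpa [tt, ti] using this

lemma ti_mul_tt (a : ℤ) : ti a * tt a = 1 := by
  have := RingQuot.mkAlgHom_rel K (BRel.TinvT a)
  simpa [tt, ti] using this

lemma tt_mul_ff (a b : ℤ) :
    tt a * ff b = q ^ (-cf a b - cf (-a - 1) b) • (ff b * tt a) := by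
  have h := RingQuot.mkAlgHom_rel K (BRel.TF a b)
  rw [map_mul, map_mul, map_smul, cf_neg] at h
  change tt a * ff b * ti a = q ^ (-(cf a b + cf (-a - 1) b)) • ff b at h
  have h2 := congrArg (· * tt a) h
  simp only [mul_assoc, ti_mul_tt, mul_one, smul_mul_assoc] at h2
  rw [h2, neg_add']

lemma ee_mul_ff (a b : ℤ) :
    ee a * ff b = q ^ (-cf a b) • (ff b * ee a) + (if a = b then 1 else 0)
      + (if -a - 1 = b then tt a else 0) := by
  have h := RingQuot.mkAlgHom_rel K (BRel.EF a b)
  rw [map_mul, map_add, map_add, map_smul, map_mul, apply_ite (RingQuot.mkAlgHom K BRel),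
    apply_ite (RingQuot.mkAlgHom K BRel), map_one, map_zero] at h
  exact h

lemma ff_far {a b : ℤ} (h : a + 1 < b ∨ b + 1 < a) : ff a * ff b = ff b * ff a := by
  have h' : 1 < |a - b| := by rw [lt_abs]; omega
  have := RingQuot.mkAlgHom_rel K (BRel.Ffar a b h')
  rwa [map_mul, map_mul] at this

lemma ff_serre {a b : ℤ} (h : a = b + 1 ∨ b = a + 1) :
    ff a * ff a * ff b + ff b * (ff a * ff a) = (q + q⁻¹) • (ff a * ff b * ff a) := by
  have h' : |a - b| = 1 := by rw [abs_eq (by norm_num)]; omega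
  have := RingQuot.mkAlgHom_rel K (BRel.Fserre a b h')
  simp only [map_mul, map_add, map_smul] at this
  exact this

/-- The segment starting at `a` with `n + 1` letters, in the parametrization `i = 2a+1`. -/
def sgm (a : ℤ) : ℕ → U
  | 0 => ff a
  | n + 1 => sgm a n * ff (a + n + 1) - q • (ff (a + n + 1) * sgm a n)

/-- The pairing of `α_k` with the weight of the segment `sgm a n`. -/
def sw (k a : ℤ) : ℕ → ℤ
  | 0 => cf k a
  | n + 1 => sw k a n + cf k (a + n + 1)

lemma sw_eq (k a : ℤ) (n : ℕ) (h : k = a + n + 1) : sw k a n = -1 := by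
  have far : ∀ n : ℕ, a + n + 1 < k → sw k a n = 0 := by
    intro n
    induction n with
    | zero => intro h; simp only [sw]; exact cf_far (by push_cast at h; omega)
    | succ n ih =>
      intro h
      simp only [sw]; push_cast at h
      rw [ih (by omega), cf_far (by omega)]; rfl
  cases n with
  | zero => simp only [sw]; exact cf_adj (by push_cast at h; omega)
  | succ n =>
    simp only [sw]; push_cast at h
    rw [far n (by omega), cf_adj (by omega)]; rfl

lemma ff_sgm_comm (a b : ℤ) (n : ℕ) (h : a + n + 1 < b) : ff b * sgm a n = sgm a n * ff b := by
  induction n with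
  | zero => exact ff_far (by push_cast at h; omega)
  | succ n ih =>
    push_cast at h
    have h1 := ih (by omega)
    have h2 : ff b * ff (a + n + 1) = ff (a + n + 1) * ff b := ff_far (by omega)
    simp only [sgm, mul_sub, sub_mul, mul_smul_comm, smul_mul_assoc]
    rw [← mul_assoc, h1, mul_assoc, h2, ← mul_assoc, ← mul_assoc (ff b), h2, mul_assoc (ff _) (ff b), h1,
      mul_assoc (ff _)]

lemma tt_mul_sgm (k a : ℤ) (n : ℕ) :
    tt k * sgm a n = q ^ (-sw k a n - sw (-k - 1) a n) • (sgm a n * tt k) := by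
  induction n with
  | zero => exact tt_mul_ff k a
  | succ n ih =>
    have h2 := tt_mul_ff k (a + n + 1)
    have e : q ^ (-sw k a (n + 1) - sw (-k - 1) a (n + 1)) =
        q ^ (-sw k a n - sw (-k - 1) a n) *
          q ^ (-cf k (a + n + 1) - cf (-k - 1) (a + n + 1)) := by
      rw [← zpow_add₀ q_ne]; congr 1; simp only [sw]; ring
    simp only [sgm, mul_sub, sub_mul, mul_smul_comm, smul_mul_assoc, smul_sub]
    rw [e, ← mul_assoc, ih, smul_mul_assoc, mul_assoc, h2, ← mul_assoc, h2, smul_mul_assoc,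
      mul_assoc _ (tt k), ih]
    simp only [mul_smul_comm, mul_assoc]
    module

/-- What is left of a segment after its first letter is removed by the corresponding `E`. -/
def lft (a : ℤ) : ℕ → U
  | 0 => 1
  | n + 1 => (1 - q ^ 2) • sgm (a + 1) n

/-- What is left of a segment after its last letter is removed by `E_k` with `k = -j`. -/
def rgt (k a : ℤ) : ℕ → U
  | 0 => tt k
  | n + 1 => ((1 - q ^ 2) * q ^ (-sw k a n)) • (sgm a n * tt k)

lemma ee_mul_sgm_aux {A : Type*} [Ring A] [Algebra K A] {E x f L R D : A} {c d : K}
    (hx : E * x = c • (x * E) + L + R) (hf : E * f = d • (f * E) + D) :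
    E * (x * f - q • (f * x)) = (c * d) • ((x * f - q • (f * x)) * E)
      + (L * f - (q * d) • (f * L)) + (R * f - (q * d) • (f * R)) +
      (c • (x * D) - q • (D * x)) := by
  rw [mul_sub, mul_smul_comm, ← mul_assoc, ← mul_assoc, hx, hf]
  simp only [add_mul, smul_mul_assoc, mul_assoc, hx, hf]
  simp only [mul_add, sub_mul, smul_mul_assoc, mul_smul_comm, mul_assoc]
  module

lemma ee_mul_sgm (k a : ℤ) (n : ℕ) :
    ee k * sgm a n = q ^ (-sw k a n) • (sgm a n * ee k) + (if k = a then lft a n else 0)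
      + (if -k - 1 = a + n then rgt k a n else 0) := by
  induction n with
  | zero =>
    simp only [sgm, sw, lft, rgt, Nat.cast_zero, add_zero]
    exact ee_mul_ff k a
  | succ n ih =>
    have hf := ee_mul_ff k (a + n + 1)
    rw [add_assoc (q ^ _ • _)] at hf
    have key := ee_mul_sgm_aux ih hf
    have e : q ^ (-sw k a (n + 1)) = q ^ (-sw k a n) * q ^ (-cf k (a + n + 1)) := by
      rw [← zpow_add₀ q_ne]; congr 1; simp only [sw]; ring
    have hL : ((if k = a then lft a n else 0) * ff (a + n + 1) -
        (q * q ^ (-cf k (a + n + 1))) • (ff (a + n + 1) * if k = a then lft a n else 0)) =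
        if k = a then lft a (n + 1) else 0 := by
      split_ifs with h
      · subst h
        cases n with
        | zero =>
          rw [cf_adj (by push_cast; omega)]
          simp only [lft, sgm, Nat.cast_zero, add_zero]
          simp only [one_mul, mul_one]
          rw [neg_neg, zpow_one, ← sq]; module
        | succ n =>
          rw [cf_far (by push_cast; omega)]
          have : k + ((n + 1 : ℕ) : ℤ) + 1 = k + 1 + n + 1 := by push_cast; ring
          simp only [lft, sgm, this]
          simp only [smul_mul_assoc, mul_smul_comm, neg_zero, zpow_zero, mul_one]
          module
      · simp
    have hR : ((if -k - 1 = a + n then rgt k a n else 0) * ff (a + n + 1) -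
        (q * q ^ (-cf k (a + n + 1))) • (ff (a + n + 1) * if -k - 1 = a + n then rgt k a n else 0))
        = 0 := by
      split_ifs with h
      · have ht := tt_mul_ff k (a + n + 1)
        rw [cf_adj (a := -k - 1) (by omega)] at ht
        have e2 : q ^ (-cf k (a + n + 1) - -1) = q * q ^ (-cf k (a + n + 1)) := by
          rw [sub_neg_eq_add, zpow_add_one₀ q_ne, mul_comm]
        rw [e2] at ht
        cases n with
        | zero => rw [rgt, ht]; simp
        | succ n =>
          have hc := ff_sgm_comm a (a + ((n + 1 : ℕ) : ℤ) + 1) n (by push_cast; omega)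
          simp only [rgt, smul_mul_assoc, mul_smul_comm]
          rw [mul_assoc, ht, ← mul_assoc, hc]
          simp only [mul_assoc, mul_smul_comm]
          module
      · simp
    have e3 : (a : ℤ) + ((n + 1 : ℕ) : ℤ) = a + n + 1 := by push_cast; ring
    have h1 : q ^ (-sw k a n) • (sgm a n * if k = a + n + 1 then (1 : U) else 0) -
        q • ((if k = a + n + 1 then (1 : U) else 0) * sgm a n) = 0 := by
      split_ifs with h
      · rw [sw_eq k a n h]; simp
      · simp
    have h2 : q ^ (-sw k a n) • (sgm a n * if -k - 1 = a + n + 1 then tt k else 0) -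
        q • ((if -k - 1 = a + n + 1 then tt k else 0) * sgm a n) =
        if -k - 1 = a + n + 1 then rgt k a (n + 1) else 0 := by
      split_ifs with h
      · rw [tt_mul_sgm, sw_eq (-k - 1) a n h, rgt, smul_smul, sub_neg_eq_add, zpow_add_one₀ q_ne]
        module
      · simp
    have hD : ∀ x y x' y' z w : U, z = x + y → w = x' + y' →
        q ^ (-sw k a n) • (sgm a n * x) - q • (x' * sgm a n) = 0 →
        q ^ (-sw k a n) • (sgm a n * z) - q • (w * sgm a n) =
        q ^ (-sw k a n) • (sgm a n * y) - q • (y' * sgm a n) := by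
      intro x y x' y' z w hz hw h
      rw [hz, hw, mul_add, add_mul, smul_add, smul_add, add_sub_add_comm, h, zero_add]
    rw [sgm, key, e, hL, hR, hD _ _ _ _ _ _ rfl rfl h1, h2, add_zero, e3]
end BTheta

namespace BTheta

/-- `x` is, up to a power of `q`, a polynomial in `q` with positive value at `q = 1`. -/
def Pos (x : K) : Prop :=
  ∃ n : ℕ, ∃ p : Polynomial ℚ, q ^ n * x = algebraMap (Polynomial ℚ) K p ∧ 0 < p.eval 1

lemma q_eq : q = algebraMap (Polynomial ℚ) K Polynomial.X := RatFunc.algebraMap_X.symm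

lemma Pos.ne_zero {x : K} (h : Pos x) : x ≠ 0 := by
  rintro rfl
  obtain ⟨n, p, h1, h2⟩ := h
  rw [mul_zero, eq_comm, map_eq_zero_iff _ (RatFunc.algebraMap_injective ℚ)] at h1
  simp [h1] at h2

lemma Pos.mul {x y : K} (hx : Pos x) (hy : Pos y) : Pos (x * y) := by
  obtain ⟨n, p, h1, h2⟩ := hx
  obtain ⟨m, r, h3, h4⟩ := hy
  refine ⟨n + m, p * r, ?_, by simpa using mul_pos h2 h4⟩
  rw [map_mul, ← h1, ← h3]; ring

lemma Pos.add {x y : K} (hx : Pos x) (hy : Pos y) : Pos (x + y) := by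
  obtain ⟨n, p, h1, h2⟩ := hx
  obtain ⟨m, r, h3, h4⟩ := hy
  refine ⟨n + m, Polynomial.X ^ m * p + Polynomial.X ^ n * r, ?_, ?_⟩
  · rw [map_add, map_mul, map_mul, map_pow, map_pow, ← q_eq, ← h1, ← h3]; ring
  · simpa using add_pos h2 h4

lemma pos_zpow (z : ℤ) : Pos (q ^ z) := by
  refine ⟨z.natAbs, Polynomial.X ^ (z.natAbs + z).toNat, ?_, by simp⟩
  rw [map_pow, ← q_eq, ← zpow_natCast, ← zpow_natCast, ← zpow_add₀ q_ne]
  congr 1; omega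

lemma pos_one : Pos 1 := by simpa using pos_zpow 0

lemma q_pow_ne_one (n : ℕ) (hn : n ≠ 0) : q ^ n ≠ 1 := by
  intro h
  rw [q_eq, ← map_pow, ← map_one (algebraMap (Polynomial ℚ) K)] at h
  have := congrArg (Polynomial.eval 0) (RatFunc.algebraMap_injective ℚ h)
  simp [hn] at this

lemma one_sub_ne : (1 - q ^ 2 : K) ≠ 0 := sub_ne_zero.2 (q_pow_ne_one 2 two_ne_zero).symm

/-- The product `E_{k+t-1} ⋯ E_{k+1} E_k`. -/
def Ech : ℤ → ℕ → U
  | _, 0 => 1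
  | k, t + 1 => Ech (k + 1) t * ee k

lemma Ech_mul_sgm (k a : ℤ) (n t : ℕ) (h1 : a < k) (h2 : -(a + n) - 1 < k) :
    ∃ z : ℤ, Ech k t * sgm a n = q ^ z • (sgm a n * Ech k t) := by
  induction t generalizing k with
  | zero => exact ⟨0, by simp [Ech]⟩
  | succ t ih =>
    obtain ⟨z, hz⟩ := ih (k + 1) (by omega) (by omega)
    refine ⟨-sw k a n + z, ?_⟩
    rw [Ech, mul_assoc, ee_mul_sgm, if_neg (by omega), if_neg (by omega), add_zero, add_zero,
      mul_smul_comm, ← mul_assoc, hz, smul_mul_assoc, smul_smul, mul_assoc, ← zpow_add₀ q_ne]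

lemma Ech_succ_smul_eq_zero {M : Type*} [AddCommGroup M] [Module U M] {k : ℤ} {t : ℕ} {X : M}
    (h : ee k • X = 0) : Ech k (t + 1) • X = 0 := by
  rw [Ech, mul_smul, h, smul_zero]

variable {M : Type*} [AddCommGroup M] [Module K M] [Module U M] [IsScalarTower K U M]

lemma ee_smul_sgm_smul (k a : ℤ) (n : ℕ) (X : M) :
    ee k • sgm a n • X = q ^ (-sw k a n) • sgm a n • ee k • X + (if k = a then lft a n • X else 0)
      + (if -k - 1 = a + n then rgt k a n • X else 0) := by
  rw [← mul_smul, ee_mul_sgm, add_smul, add_smul, smul_assoc, mul_smul]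
  congr 1
  · congr 1
    split_ifs <;> simp
  · split_ifs <;> simp

lemma Ech_lft (a k : ℤ) (t' t : ℕ) (X : M) (hX : ∀ k, a < k → ee k • X = 0) (hk : a < k)
    (hb : -(k + t') - 1 ≤ a) (ht : t' ≤ t) :
    Ech k (t + 1) • sgm k t' • X = if t' = t then (1 - q ^ 2) ^ t • X else 0 := by
  induction t' generalizing k t with
  | zero =>
    push_cast at hb
    rw [Ech, mul_smul, ee_smul_sgm_smul, hX k hk, if_pos rfl, if_neg (by push_cast; omega),
      smul_zero, smul_zero, zero_add, add_zero, lft, one_smul]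
    cases t with
    | zero => simp [Ech]
    | succ t => rw [Ech_succ_smul_eq_zero (hX _ (by omega)), if_neg (by omega)]
  | succ t' ih =>
    push_cast at hb
    rw [Ech, mul_smul, ee_smul_sgm_smul, hX k hk, if_pos rfl, if_neg (by push_cast; omega),
      smul_zero, smul_zero, zero_add, add_zero, lft]
    obtain ⟨t, rfl⟩ : ∃ s, t = s + 1 := ⟨t - 1, by omega⟩
    rw [smul_assoc, smul_comm, ih (k + 1) t (by omega) (by omega) (by omega)]
    simp only [Nat.add_right_cancel_iff, smul_ite, smul_zero, smul_smul, pow_succ']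

lemma Ech_rgt (a k : ℤ) (t' t : ℕ) (X : M) (hX : ∀ k, a < k → ee k • X = 0)
    (hT : ∀ k, ∃ z : ℤ, tt k • X = q ^ z • X) (hk : a < k)
    (hb : -k - 1 = a + t') (ht : t' ≤ t) :
    ∃ z : ℤ, Ech k (t + 1) • sgm a t' • X =
      if t' = t then ((1 - q ^ 2) ^ t * q ^ z) • X else 0 := by
  obtain ⟨z, hz⟩ := hT k
  induction t' generalizing k t z with
  | zero =>
    refine ⟨z, ?_⟩
    push_cast at hb
    rw [Ech, mul_smul, ee_smul_sgm_smul, hX k hk, if_neg (by omega), if_pos (by push_cast; omega),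
      smul_zero, smul_zero, zero_add, zero_add, rgt, hz]
    cases t with
    | zero => simp [Ech]
    | succ t =>
      rw [smul_comm, Ech_succ_smul_eq_zero (hX _ (by omega)), if_neg (by omega), smul_zero]
  | succ t' ih =>
    push_cast at hb
    obtain ⟨t, rfl⟩ : ∃ s, t = s + 1 := ⟨t - 1, by omega⟩
    obtain ⟨y, hy⟩ := hT (k + 1)
    obtain ⟨x, hx⟩ := ih (k + 1) t (by omega) (by omega) (by omega) y hy
    refine ⟨-sw k a t' + z + x, ?_⟩
    rw [Ech, mul_smul, ee_smul_sgm_smul, hX k hk, if_neg (by omega), if_pos (by push_cast; omega),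
      smul_zero, smul_zero, zero_add, zero_add, rgt, smul_assoc, mul_smul (sgm _ _), hz,
      smul_comm (sgm _ _), smul_comm (Ech _ _), smul_comm (Ech _ _), hx]
    simp only [Nat.add_right_cancel_iff, smul_ite, smul_zero, smul_smul]
    congr 2
    rw [zpow_add₀ q_ne, zpow_add₀ q_ne]; ring

/-- The segment `s = (a, n)` is `θ`-restricted. -/
def IsTh (s : ℤ × ℕ) : Prop := 0 ≤ s.1 + s.1 + s.2 + 1

lemma Ech_sgm (a : ℤ) (n : ℕ) (a' : ℤ) (n' : ℕ) (hs : IsTh (a', n'))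
    (hle : a' < a ∨ (a' = a ∧ n' ≤ n)) (X : M) (hX : ∀ k, a < k → ee k • X = 0)
    (hT : ∀ k, ∃ z : ℤ, tt k • X = q ^ z • X) :
    ∃ z : ℤ, ∃ p : K, Pos p ∧ Ech a (n + 1) • sgm a' n' • X =
      q ^ z • sgm a' n' • Ech a (n + 1) • X +
        if (a', n') = (a, n) then ((1 - q ^ 2) ^ n * p) • X else 0 := by
  simp only [IsTh] at hs
  rcases hle with hlt | ⟨rfl, hn⟩
  · obtain ⟨z, hz⟩ := Ech_mul_sgm a a' n' (n + 1) hlt (by omega)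
    refine ⟨z, 1, pos_one, ?_⟩
    rw [← mul_smul, hz, smul_assoc, mul_smul, if_neg, add_zero]
    simp only [Prod.mk.injEq]; omega
  · obtain ⟨z, hz⟩ := Ech_mul_sgm (a' + 1) a' n' n (by omega) (by omega)
    have hL : Ech (a' + 1) n • lft a' n' • X = if n' = n then (1 - q ^ 2) ^ n • X else 0 := by
      cases n' with
      | zero =>
        cases n with
        | zero => simp [Ech, lft]
        | succ n =>
          rw [lft, one_smul, Ech_succ_smul_eq_zero (hX _ (by omega)), if_neg (by omega)]
      | succ n' =>
        obtain ⟨n, rfl⟩ : ∃ s, n = s + 1 := ⟨n - 1, by omega⟩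
        rw [lft, smul_assoc, smul_comm, Ech_lft a' (a' + 1) n' n X hX (by omega)
          (by push_cast at hs; omega) (by omega)]
        simp only [Nat.add_right_cancel_iff, smul_ite, smul_zero, smul_smul, pow_succ']
    have hR : ∃ y : ℤ, -a' - 1 = a' + n' → Ech (a' + 1) n • rgt a' a' n' • X =
        if n' = n then ((1 - q ^ 2) ^ n * q ^ y) • X else 0 := by
      by_cases hth : -a' - 1 = a' + n'
      · cases n' with
        | zero => push_cast at hth; omega
        | succ n' =>
          obtain ⟨n, rfl⟩ : ∃ s, n = s + 1 := ⟨n - 1, by omega⟩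
          obtain ⟨x, hx⟩ := hT a'
          push_cast at hth
          obtain ⟨y, hy⟩ := Ech_rgt a' (a' + 1) n' n X hX hT (by omega) (by omega) (by omega)
          refine ⟨-sw a' a' n' + x + y, fun _ => ?_⟩
          rw [rgt, smul_assoc, mul_smul (sgm _ _), hx,
            smul_comm (sgm _ _), smul_comm (Ech _ _), smul_comm (Ech _ _), hy]
          simp only [Nat.add_right_cancel_iff, smul_ite, smul_zero, smul_smul]
          congr 2
          rw [zpow_add₀ q_ne, zpow_add₀ q_ne]; ring
      · exact ⟨0, fun h => absurd h hth⟩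
    obtain ⟨y, hy⟩ := hR
    refine ⟨-sw a' a' n' + z, if -a' - 1 = a' + n' then 1 + q ^ y else 1, ?_, ?_⟩
    · split_ifs
      exacts [pos_one.add (pos_zpow y), pos_one]
    · rw [Ech, mul_smul, ee_smul_sgm_smul, if_pos rfl, smul_add, smul_add, hL, smul_comm (Ech _ _),
        ← mul_smul (Ech _ _), hz, smul_assoc, smul_smul, ← zpow_add₀ q_ne, mul_smul, add_assoc,
        ← mul_smul (Ech _ _)]
      congr 1
      simp only [Prod.mk.injEq, true_and]
      by_cases hth : -a' - 1 = a' + n'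
      · rw [if_pos hth, if_pos hth, hy hth]
        split_ifs
        · rw [← add_smul]; congr 1; ring
        · simp
      · rw [if_neg hth, if_neg hth]
        simp

/-- The product of a list of segments. -/
def prd (L : List (ℤ × ℕ)) : U := (L.map fun s => sgm s.1 s.2).prod

lemma prd_cons (s : ℤ × ℕ) (L : List (ℤ × ℕ)) : prd (s :: L) = sgm s.1 s.2 * prd L := by
  simp [prd]

lemma prd_append (L L' : List (ℤ × ℕ)) : prd (L ++ L') = prd L * prd L' := by
  simp [prd]

/-- The (decreasing) PBW order on segments. -/
def pge (s t : ℤ × ℕ) : Prop := t.1 + t.2 < s.1 + s.2 ∨ (t.1 + t.2 = s.1 + s.2 ∧ t.1 ≤ s.1)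

lemma pge_antisymm {s t : ℤ × ℕ} (h : pge s t) (h' : pge t s) : s = t := by
  simp only [pge] at h h'
  ext <;> omega

variable {v : M}

lemma ee_prd_eq_zero (hE : ∀ k, ee k • v = 0) (a : ℤ) (L : List (ℤ × ℕ))
    (hL : ∀ s ∈ L, IsTh s ∧ s.1 ≤ a) (k : ℤ) (hk : a < k) : ee k • prd L • v = 0 := by
  induction L with
  | nil => simpa [prd] using hE k
  | cons s L ih =>
    have h := hL s (by simp)
    simp only [IsTh] at h
    rw [prd_cons, mul_smul, ee_smul_sgm_smul, ih fun t ht => hL t (by simp [ht]),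
      if_neg (by omega), if_neg (by omega)]
    simp

lemma tt_prd (hT : ∀ k, tt k • v = v) (L : List (ℤ × ℕ)) (k : ℤ) :
    ∃ z : ℤ, tt k • prd L • v = q ^ z • prd L • v := by
  induction L with
  | nil => exact ⟨0, by simpa [prd] using hT k⟩
  | cons s L ih =>
    obtain ⟨z, hz⟩ := ih
    refine ⟨-sw k s.1 s.2 - sw (-k - 1) s.1 s.2 + z, ?_⟩
    rw [prd_cons, mul_smul, ← mul_smul (tt k), tt_mul_sgm, smul_assoc, mul_smul, hz,
      smul_comm (sgm _ _), smul_smul, ← zpow_add₀ q_ne]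

lemma Ech_prd (hE : ∀ k, ee k • v = 0) (hT : ∀ k, tt k • v = v) (l : ℤ × ℕ)
    (L : List (ℤ × ℕ)) (hs : L.Pairwise pge) (hth : ∀ s ∈ L, IsTh s)
    (hle : ∀ s ∈ L, s.1 < l.1 ∨ (s.1 = l.1 ∧ s.2 ≤ l.2)) :
    ∃ p : K, Pos p ∧ Ech l.1 (l.2 + 1) • prd L • v =
      if l ∈ L then ((1 - q ^ 2) ^ l.2 * p) • prd (L.erase l) • v else 0 := by
  induction L with
  | nil =>
    refine ⟨1, pos_one, ?_⟩
    simp only [prd, List.map_nil, List.prod_nil, one_smul, List.not_mem_nil, if_false]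
    exact Ech_succ_smul_eq_zero (hE _)
  | cons s L ih =>
    rw [List.pairwise_cons] at hs
    obtain ⟨p, hp, h⟩ := ih hs.2 (fun t ht => hth t (by simp [ht])) fun t ht => hle t (by simp [ht])
    obtain ⟨z, p', hp', h'⟩ := Ech_sgm l.1 l.2 s.1 s.2 (hth s (by simp)) (hle s (by simp))
      (prd L • v) (ee_prd_eq_zero hE l.1 L fun t ht => ⟨hth t (by simp [ht]), by
        have := hle t (by simp [ht]); omega⟩) (tt_prd hT L)
    rw [prd_cons, mul_smul, h', h]
    by_cases hsl : s = l
    · subst hsl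
      simp only [if_true, List.mem_cons, true_or, List.erase_cons_head]
      by_cases hm : s ∈ L
      · refine ⟨q ^ z * p + p', ((pos_zpow z).mul hp).add hp', ?_⟩
        obtain ⟨L', rfl⟩ : ∃ L', L = s :: L' := by
          cases L with
          | nil => simp at hm
          | cons t L' =>
            refine ⟨L', ?_⟩
            rcases List.mem_cons.1 hm with rfl | hm'
            · rfl
            · rw [pge_antisymm (hs.1 t (by simp)) ((List.pairwise_cons.1 hs.2).1 s hm')]
        rw [if_pos hm, List.erase_cons_head, smul_comm (sgm _ _), ← mul_smul (sgm _ _),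
          ← prd_cons, smul_smul, ← add_smul]
        congr 1; ring
      · refine ⟨p', hp', ?_⟩
        rw [if_neg hm, smul_zero, smul_zero, zero_add]
    · refine ⟨q ^ z * p, (pos_zpow z).mul hp, ?_⟩
      rw [if_neg hsl, add_zero, List.erase_cons_tail (by simpa using hsl)]
      simp only [List.mem_cons, Ne.symm hsl, false_or]
      split_ifs
      · rw [smul_comm (sgm _ _), ← mul_smul (sgm _ _), ← prd_cons, smul_smul]
        congr 1; ring
      · simp

lemma exists_Ech_reduction (hE : ∀ k, ee k • v = 0) (hT : ∀ k, tt k • v = v) {ι : Type*}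
    (S : Finset ι) (L : ι → List (ℤ × ℕ)) (c : ι → K) (hs : ∀ i ∈ S, (L i).Pairwise pge)
    (hth : ∀ i ∈ S, ∀ s ∈ L i, IsTh s) (hc : ∀ i ∈ S, c i ≠ 0) (hinj : Set.InjOn L S)
    (hne : ∃ i ∈ S, L i ≠ []) :
    ∃ (a : ℤ) (n : ℕ) (S' : Finset ι) (L' : ι → List (ℤ × ℕ)) (c' : ι → K),
      (∀ i ∈ S', (L' i).Pairwise pge) ∧ (∀ i ∈ S', ∀ s ∈ L' i, IsTh s) ∧ (∀ i ∈ S', c' i ≠ 0) ∧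
      Set.InjOn L' S' ∧ S'.Nonempty ∧ ∑ i ∈ S', (L' i).length < ∑ i ∈ S, (L i).length ∧
      Ech a (n + 1) • ∑ i ∈ S, c i • prd (L i) • v = ∑ i ∈ S', c' i • prd (L' i) • v := by
  obtain ⟨l, hl, hmax⟩ := Finset.exists_max_image (S.biUnion fun i => (L i).toFinset)
    (fun s => (toLex s : ℤ ×ₗ ℕ)) (by
      obtain ⟨i, hi, h⟩ := hne
      obtain ⟨s, hs⟩ := List.exists_mem_of_ne_nil _ h
      exact ⟨s, by simp only [Finset.mem_biUnion, List.mem_toFinset]; exact ⟨i, hi, hs⟩⟩)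
  simp only [Finset.mem_biUnion, List.mem_toFinset] at hl hmax
  obtain ⟨i₀, hi₀, hl₀⟩ := hl
  have hle : ∀ i ∈ S, ∀ s ∈ L i, s.1 < l.1 ∨ (s.1 = l.1 ∧ s.2 ≤ l.2) := by
    intro i hi s hs
    have := hmax s ⟨i, hi, hs⟩
    rwa [Prod.Lex.toLex_le_toLex] at this
  have key : ∀ i, ∃ p : K, i ∈ S → Pos p ∧ Ech l.1 (l.2 + 1) • prd (L i) • v =
      if l ∈ L i then ((1 - q ^ 2) ^ l.2 * p) • prd ((L i).erase l) • v else 0 := by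
    intro i
    by_cases hi : i ∈ S
    · obtain ⟨p, hp⟩ := Ech_prd hE hT l (L i) (hs i hi) (hth i hi) (hle i hi)
      exact ⟨p, fun _ => hp⟩
    · exact ⟨0, fun h => absurd h hi⟩
  choose p hp using key
  refine ⟨l.1, l.2, S.filter fun i => l ∈ L i, fun i => (L i).erase l,
    fun i => c i * ((1 - q ^ 2) ^ l.2 * p i), ?_, ?_, ?_, ?_, ?_, ?_, ?_⟩
  · intro i hi
    exact (hs i (Finset.mem_filter.1 hi).1).sublist List.erase_sublist
  · intro i hi s hsi
    exact hth i (Finset.mem_filter.1 hi).1 s (List.mem_of_mem_erase hsi)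
  · intro i hi
    have hi := (Finset.mem_filter.1 hi).1
    exact mul_ne_zero (hc i hi) (mul_ne_zero (pow_ne_zero _ one_sub_ne) (hp i hi).1.ne_zero)
  · intro i hi j hj hij
    have hi' := Finset.mem_filter.1 hi
    have hj' := Finset.mem_filter.1 hj
    refine hinj hi'.1 hj'.1 ?_
    have hij' : (L i).erase l = (L j).erase l := hij
    have h : (L i).Perm (L j) := by
      have h1 := List.perm_cons_erase hi'.2
      rw [hij'] at h1
      exact h1.trans (List.perm_cons_erase hj'.2).symm
    exact h.eq_of_pairwise (fun a b _ _ hab hba => pge_antisymm hab hba) (hs i hi'.1) (hs j hj'.1)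
  · exact ⟨i₀, Finset.mem_filter.2 ⟨hi₀, hl₀⟩⟩
  · have h1 : ∑ i ∈ S.filter (fun i => l ∈ L i), ((L i).erase l).length <
        ∑ i ∈ S.filter (fun i => l ∈ L i), (L i).length := by
      refine Finset.sum_lt_sum_of_nonempty ⟨i₀, Finset.mem_filter.2 ⟨hi₀, hl₀⟩⟩ fun i hi => ?_
      have hi := (Finset.mem_filter.1 hi).2
      rw [List.length_erase_of_mem hi]
      have := List.length_pos_of_mem hi
      omega
    exact h1.trans_le (Finset.sum_le_sum_of_subset (Finset.filter_subset _ _))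
  · rw [Finset.smul_sum, Finset.sum_filter]
    refine Finset.sum_congr rfl fun i hi => ?_
    rw [smul_comm, (hp i hi).2]
    split_ifs
    · rw [smul_smul]
    · simp

lemma exists_smul_eq_smul (hE : ∀ k, ee k • v = 0) (hT : ∀ k, tt k • v = v) {ι : Type*}
    (S : Finset ι) (L : ι → List (ℤ × ℕ)) (c : ι → K) (hs : ∀ i ∈ S, (L i).Pairwise pge)
    (hth : ∀ i ∈ S, ∀ s ∈ L i, IsTh s) (hc : ∀ i ∈ S, c i ≠ 0) (hinj : Set.InjOn L S)
    (hS : S.Nonempty) :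
    ∃ (x : U) (d : K), d ≠ 0 ∧ x • ∑ i ∈ S, c i • prd (L i) • v = d • v := by
  induction hN : ∑ i ∈ S, (L i).length using Nat.strong_induction_on generalizing S L c with
  | _ N ih =>
    by_cases hne : ∃ i ∈ S, L i ≠ []
    · obtain ⟨a, n, S', L', c', h1, h2, h3, h4, h5, h6, h7⟩ :=
        exists_Ech_reduction hE hT S L c hs hth hc hinj hne
      obtain ⟨x, d, hd, hx⟩ := ih _ (hN ▸ h6) S' L' c' h1 h2 h3 h4 h5 rfl
      exact ⟨x * Ech a (n + 1), d, hd, by rw [mul_smul, h7, hx]⟩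
    · push Not at hne
      obtain ⟨i, hi⟩ := hS
      have hSi : S = {i} := by
        refine Finset.eq_singleton_iff_unique_mem.2 ⟨hi, fun j hj => hinj hj hi ?_⟩
        rw [hne i hi, hne j hj]
      refine ⟨1, c i, hc i hi, ?_⟩
      rw [hSi, Finset.sum_singleton, hne i hi, one_smul, prd, List.map_nil, List.prod_nil, one_smul]

end BTheta

namespace BTheta

section Serre
variable {A : Type*} [Ring A] [Algebra K A]

/-- The quantum Serre element. -/
def serre (F G : A) : A := F * F * G + G * (F * F) - (q + q⁻¹) • (F * G * F)

lemma mul_serre {E F G T : A} {x y x' y' α β α' β' : K}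
    (hF : E * F = x • (F * E) + α • (1 : A) + α' • T)
    (hG : E * G = y • (G * E) + β • (1 : A) + β' • T)
    (hTF : T * F = (x * x') • (F * T)) (hTG : T * G = (y * y') • (G * T))
    (hα : α ≠ 0 → x = q⁻¹ * q⁻¹ ∧ y = q) (hβ : β ≠ 0 → x = q)
    (hα' : α' ≠ 0 → x' = q⁻¹ * q⁻¹ ∧ y' = q) (hβ' : β' ≠ 0 → x' = q) :
    E * serre F G = (x * x * y) • (serre F G * E) := by
  have hF' : ∀ z : A, E * (F * z) = x • (F * (E * z)) + α • z + α' • (T * z) := by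
    intro z; rw [← mul_assoc, hF]; simp only [add_mul, smul_mul_assoc, one_mul, mul_assoc]
  have hG' : ∀ z : A, E * (G * z) = y • (G * (E * z)) + β • z + β' • (T * z) := by
    intro z; rw [← mul_assoc, hG]; simp only [add_mul, smul_mul_assoc, one_mul, mul_assoc]
  have hTF' : ∀ z : A, T * (F * z) = (x * x') • (F * (T * z)) := by
    intro z; rw [← mul_assoc, hTF]; simp only [smul_mul_assoc, mul_assoc]
  have hTG' : ∀ z : A, T * (G * z) = (y * y') • (G * (T * z)) := by
    intro z; rw [← mul_assoc, hTG]; simp only [smul_mul_assoc, mul_assoc]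
  have q0 := q_ne
  have c1 : α * (1 + x - (q + q⁻¹) * (x * y)) = 0 := by
    by_cases h : α = 0
    · simp [h]
    · obtain ⟨h1, h2⟩ := hα h
      rw [h1, h2]; field_simp; ring
  have c2 : α * (y * (1 + x) - (q + q⁻¹)) = 0 := by
    by_cases h : α = 0
    · simp [h]
    · obtain ⟨h1, h2⟩ := hα h
      rw [h1, h2]; field_simp; ring
  have c3 : β * (x * x + 1 - (q + q⁻¹) * x) = 0 := by
    by_cases h : β = 0
    · simp [h]
    · rw [hβ h]; field_simp; ring
  have d1 : α' * ((x + x * x') * (y * y') - (q + q⁻¹) * (x * y)) = 0 := by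
    by_cases h : α' = 0
    · simp [h]
    · obtain ⟨h1, h2⟩ := hα' h
      rw [h1, h2]; field_simp; ring
  have d2 : α' * (y * (x + x * x') - (q + q⁻¹) * ((y * y') * (x * x'))) = 0 := by
    by_cases h : α' = 0
    · simp [h]
    · obtain ⟨h1, h2⟩ := hα' h
      rw [h1, h2]; field_simp; ring
  have d3 : β' * (x * x + (x * x') * (x * x') - (q + q⁻¹) * (x * (x * x'))) = 0 := by
    by_cases h : β' = 0
    · simp [h]
    · rw [hβ' h]; field_simp; ring
  simp only [serre, mul_add, mul_sub, add_mul, sub_mul, mul_smul_comm, smul_mul_assoc, mul_assoc,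
    hF, hG, hF', hG', hTF, hTG, hTF', hTG', smul_add, smul_sub, smul_smul, mul_one]
  linear_combination (norm := module) c1 • (F * G) + c2 • (G * F) + c3 • (F * F) + d1 • (F * (G * T)) +
    d2 • (G * (F * T)) + d3 • (F * (F * T))

lemma mul_commutator {E F G T : A} {x y x' y' α β α' β' : K}
    (hF : E * F = x • (F * E) + α • (1 : A) + α' • T)
    (hG : E * G = y • (G * E) + β • (1 : A) + β' • T)
    (hTF : T * F = (x * x') • (F * T)) (hTG : T * G = (y * y') • (G * T))
    (hα : α ≠ 0 → y = 1) (hβ : β ≠ 0 → x = 1)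
    (hα' : α' ≠ 0 → y' = 1) (hβ' : β' ≠ 0 → x' = 1) :
    E * (F * G - G * F) = (x * y) • ((F * G - G * F) * E) := by
  have hF' : ∀ z : A, E * (F * z) = x • (F * (E * z)) + α • z + α' • (T * z) := by
    intro z; rw [← mul_assoc, hF]; simp only [add_mul, smul_mul_assoc, one_mul, mul_assoc]
  have hG' : ∀ z : A, E * (G * z) = y • (G * (E * z)) + β • z + β' • (T * z) := by
    intro z; rw [← mul_assoc, hG]; simp only [add_mul, smul_mul_assoc, one_mul, mul_assoc]
  have c1 : α * (1 - y) = 0 := by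
    by_cases h : α = 0
    · simp [h]
    · simp [hα h]
  have c2 : β * (x - 1) = 0 := by
    by_cases h : β = 0
    · simp [h]
    · simp [hβ h]
  have d1 : α' * (y * y' - y) = 0 := by
    by_cases h : α' = 0
    · simp [h]
    · simp [hα' h]
  have d2 : β' * (x - x * x') = 0 := by
    by_cases h : β' = 0
    · simp [h]
    · simp [hβ' h]
  simp only [mul_sub, sub_mul, mul_assoc, mul_add, mul_smul_comm,
    hF, hG, hF', hG', hTF, hTG, smul_add, smul_sub, smul_smul, mul_one]
  linear_combination (norm := module) c1 • G + c2 • F + d1 • (G * T) + d2 • (F * T)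

end Serre

/-- Functions on words, on which the generators of `B_θ` act. -/
abbrev Wd : Type := List ℤ → K

/-- The exponent of `T_a` on a word. -/
def wt (a : ℤ) (w : List ℤ) : ℤ := (w.map fun b => cf a b + cf (-a - 1) b).sum

lemma wt_cons (a b : ℤ) (w : List ℤ) : wt a (b :: w) = cf a b + cf (-a - 1) b + wt a w := by
  simp [wt]

/-- The operator `E_a` on functions on words. -/
def wE (a : ℤ) : Module.End K Wd := LinearMap.funLeft K K (List.cons a)

/-- The diagonal operator with exponents given by `σ`. -/
def wD (σ : List ℤ → ℤ) : Module.End K Wd where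
  toFun ψ w := q ^ σ w * ψ w
  map_add' ψ ψ' := by ext w; simp [mul_add]
  map_smul' c ψ := by ext w; simp [mul_left_comm]

/-- The operator `T_a` on functions on words. -/
def wT (a : ℤ) : Module.End K Wd := wD fun w => -wt a w

/-- The operator `T_a⁻¹` on functions on words. -/
def wTi (a : ℤ) : Module.End K Wd := wD fun w => wt a w

/-- The values of the operator `F_b` on functions on words. -/
def wFv (b : ℤ) : List ℤ → (Wd →ₗ[K] K)
  | [] => 0
  | a :: w => q ^ (-cf a b) • (wFv b w ∘ₗ wE a) + (if a = b then 1 else 0 : K) • LinearMap.proj w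
      + (if -a - 1 = b then 1 else 0 : K) • (LinearMap.proj w ∘ₗ wT a)

/-- The operator `F_b` on functions on words. -/
def wF (b : ℤ) : Module.End K Wd := LinearMap.pi (wFv b)

lemma wE_apply (a : ℤ) (ψ : Wd) (w : List ℤ) : wE a ψ w = ψ (a :: w) := rfl

lemma wT_apply (a : ℤ) (ψ : Wd) (w : List ℤ) : wT a ψ w = q ^ (-wt a w) * ψ w := rfl

lemma wF_nil (b : ℤ) (ψ : Wd) : wF b ψ [] = 0 := rfl

lemma wF_cons (b a : ℤ) (ψ : Wd) (w : List ℤ) :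
    wF b ψ (a :: w) = q ^ (-cf a b) * wF b (wE a ψ) w + (if a = b then 1 else 0) * ψ w
      + (if -a - 1 = b then 1 else 0) * wT a ψ w := rfl

lemma wE_mul_wF (a b : ℤ) :
    wE a * wF b = q ^ (-cf a b) • (wF b * wE a) + (if a = b then 1 else 0 : K) • 1
      + (if -a - 1 = b then 1 else 0 : K) • wT a := rfl

lemma wT_mul_wE (a b : ℤ) :
    wT a * wE b = q ^ (cf a b + cf (-a - 1) b) • (wE b * wT a) := by
  ext ψ w
  change q ^ (-wt a w) * ψ (b :: w) = q ^ (cf a b + cf (-a - 1) b) * (q ^ (-wt a (b :: w)) * _)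
  rw [wt_cons, ← mul_assoc, ← zpow_add₀ q_ne]
  congr 2; ring

lemma wT_mul_wTi (a : ℤ) : wT a * wTi a = 1 := by
  ext ψ w
  change q ^ (-wt a w) * (q ^ (wt a w) * ψ w) = ψ w
  rw [← mul_assoc, ← zpow_add₀ q_ne]; simp

lemma wTi_mul_wT (a : ℤ) : wTi a * wT a = 1 := by
  ext ψ w
  change q ^ (wt a w) * (q ^ (-wt a w) * ψ w) = ψ w
  rw [← mul_assoc, ← zpow_add₀ q_ne]; simp

lemma wT_comm (a b : ℤ) : wT a * wT b = wT b * wT a := by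
  ext ψ w
  change q ^ (-wt a w) * (q ^ (-wt b w) * ψ w) = q ^ (-wt b w) * (q ^ (-wt a w) * ψ w)
  ring

lemma wt_theta (a : ℤ) (w : List ℤ) : wt (-a - 1) w = wt a w := by
  simp only [wt]
  congr 1
  refine List.map_congr_left fun b _ => ?_
  rw [show -(-a - 1) - 1 = a by ring, add_comm]

lemma wT_theta (a : ℤ) : wT (-a - 1) = wT a := by
  simp only [wT, wt_theta]

lemma wT_mul_wF (a b : ℤ) :
    wT a * wF b = q ^ (-cf a b - cf (-a - 1) b) • (wF b * wT a) := by
  ext ψ w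
  change wT a (wF b ψ) w = q ^ (-cf a b - cf (-a - 1) b) * wF b (wT a ψ) w
  induction w generalizing ψ with
  | nil => rw [wT_apply, wF_nil, wF_nil, mul_zero, mul_zero]
  | cons c w ih =>
    have h : wE c (wT a ψ) = q ^ (-(cf a c + cf (-a - 1) c)) • wT a (wE c ψ) := by
      have := congrArg (· ψ) (wT_mul_wE a c)
      change wT a (wE c ψ) =
        q ^ (cf a c + cf (-a - 1) c) • wE c (wT a ψ) at this
      rw [this, smul_smul, ← zpow_add₀ q_ne]; simp
    have ih := ih (wE c ψ)
    rw [wT_apply] at ih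
    have ih' : wF b (wT a (wE c ψ)) w = q ^ (cf a b + cf (-a - 1) b) *
        (q ^ (-wt a w) * wF b (wE c ψ) w) := by
      rw [ih, ← mul_assoc, ← zpow_add₀ q_ne]
      rw [show cf a b + cf (-a - 1) b + (-cf a b - cf (-a - 1) b) = 0 by ring]; simp
    rw [wT_apply, wF_cons, wF_cons, h, map_smul, Pi.smul_apply, ih', smul_eq_mul, wT_apply, wT_apply,
      wT_apply, wT_apply, wt_cons]
    have e1 : q ^ (-(cf a c + cf (-a - 1) c + wt a w)) =
      q ^ (-(cf a c + cf (-a - 1) c)) * q ^ (-wt a w) := by rw [← zpow_add₀ q_ne]; congr 1; ring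
    have e2 : q ^ (-cf a b - cf (-a - 1) b) * q ^ (cf a b + cf (-a - 1) b) = 1 := by
      rw [← zpow_add₀ q_ne, show -cf a b - cf (-a - 1) b + (cf a b + cf (-a - 1) b) = 0 by ring,
        zpow_zero]
    rw [e1]
    by_cases h1 : c = b
    · subst h1
      by_cases h2 : -c - 1 = c
      · omega
      · rw [if_pos rfl, if_neg h2, show -cf a c - cf (-a - 1) c = -(cf a c + cf (-a - 1) c) by ring]
          at *
        linear_combination (-(q ^ (-cf c c) * q ^ (-(cf a c + cf (-a - 1) c)) * q ^ (-wt a w) *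
          wF c (wE c ψ) w)) * e2
    · by_cases h2 : -c - 1 = b
      · have h3 : cf a c + cf (-a - 1) c = cf a b + cf (-a - 1) b := by
          have := cf_theta (-a - 1) c
          rw [show -(-a - 1) - 1 = a by ring] at this
          rw [← h2, cf_theta, this, add_comm]
        rw [if_neg h1, if_pos h2, h3,
          show -cf a b - cf (-a - 1) b = -(cf a b + cf (-a - 1) b) by ring] at *
        linear_combination (-(q ^ (-cf c b) * q ^ (-(cf a b + cf (-a - 1) b)) * q ^ (-wt a w) *
          wF b (wE c ψ) w)) * e2
      · rw [if_neg h1, if_neg h2]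
        linear_combination (-(q ^ (-cf c b) * q ^ (-(cf a c + cf (-a - 1) c)) * q ^ (-wt a w) *
          wF b (wE c ψ) w)) * e2

end BTheta

namespace BTheta

lemma wT_mul_wF' (a b : ℤ) :
    wT a * wF b = (q ^ (-cf a b) * q ^ (-cf (-a - 1) b)) • (wF b * wT a) := by
  rw [wT_mul_wF, sub_eq_add_neg, zpow_add₀ q_ne]

lemma ite_one_ne {p : Prop} [Decidable p] (h : (if p then 1 else 0 : K) ≠ 0) : p := by
  by_contra hp; simp [hp] at h

lemma zpow_cf_self (a : ℤ) : q ^ (-cf a a) = q⁻¹ * q⁻¹ := by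
  rw [cf_self, zpow_neg, ← mul_inv]; norm_cast; rw [sq]

lemma zpow_cf_adj {a b : ℤ} (h : a = b + 1 ∨ b = a + 1) : q ^ (-cf a b) = q := by
  rw [cf_adj h]; simp

lemma zpow_cf_far {a b : ℤ} (h : a + 1 < b ∨ b + 1 < a) : q ^ (-cf a b) = 1 := by
  rw [cf_far h]; simp

lemma serre_wF {a b : ℤ} (h : a = b + 1 ∨ b = a + 1) : serre (wF a) (wF b) = 0 := by
  refine LinearMap.ext fun ψ => funext fun w => ?_
  induction w generalizing ψ with
  | nil => simp [serre, wF_nil]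
  | cons c w ih =>
    have key := mul_serre (wE_mul_wF c a) (wE_mul_wF c b) (wT_mul_wF' c a) (wT_mul_wF' c b)
      (fun hp => by
        have := ite_one_ne hp
        subst this
        exact ⟨zpow_cf_self c, zpow_cf_adj h⟩)
      (fun hp => by
        have := ite_one_ne hp
        subst this
        exact zpow_cf_adj h.symm)
      (fun hp => by
        have := ite_one_ne hp
        subst this
        exact ⟨zpow_cf_self _, zpow_cf_adj h⟩)
      (fun hp => by
        have := ite_one_ne hp
        subst this
        exact zpow_cf_adj h.symm)
    have := congrFun (LinearMap.congr_fun key ψ) w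
    change serre (wF a) (wF b) ψ (c :: w) = _ * (serre (wF a) (wF b) (wE c ψ) w) at this
    rw [this, ih]
    exact mul_zero _

lemma wF_far {a b : ℤ} (h : a + 1 < b ∨ b + 1 < a) : wF a * wF b - wF b * wF a = 0 := by
  refine LinearMap.ext fun ψ => funext fun w => ?_
  induction w generalizing ψ with
  | nil => simp [wF_nil]
  | cons c w ih =>
    have key := mul_commutator (wE_mul_wF c a) (wE_mul_wF c b) (wT_mul_wF' c a) (wT_mul_wF' c b)
      (fun hp => by
        have := ite_one_ne hp
        subst this
        exact zpow_cf_far h)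
      (fun hp => by
        have := ite_one_ne hp
        subst this
        exact zpow_cf_far h.symm)
      (fun hp => by
        have := ite_one_ne hp
        subst this
        exact zpow_cf_far h)
      (fun hp => by
        have := ite_one_ne hp
        subst this
        exact zpow_cf_far h.symm)
    have := congrFun (LinearMap.congr_fun key ψ) w
    change (wF a * wF b - wF b * wF a) ψ (c :: w) =
      _ * ((wF a * wF b - wF b * wF a) (wE c ψ) w) at this
    rw [this, ih]
    exact mul_zero _

open MulOpposite in
lemma op_wF_mul (c a : ℤ) : op (wF c) * op (wE a) = q ^ (-cf a c) • (op (wE a) * op (wF c))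
    + (if a = c then 1 else 0 : K) • 1 + (if -a - 1 = c then 1 else 0 : K) • op (wT c) := by
  rw [← op_mul, wE_mul_wF, op_add, op_add, op_smul, op_smul, op_smul, op_mul, op_one]
  by_cases h : -a - 1 = c
  · rw [← h, wT_theta]
  · simp [h]

open MulOpposite in
lemma op_wT_mul (c a : ℤ) : op (wT c) * op (wE a) =
    (q ^ (-cf a c) * q ^ (-cf (-a - 1) c)) • (op (wE a) * op (wT c)) := by
  rw [← op_mul, ← op_mul, wT_mul_wE, op_smul, smul_smul]
  have := cf_theta (-c - 1) a
  rw [show -(-c - 1) - 1 = c by ring] at this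
  rw [← this, cf_symm c a, cf_symm c, ← zpow_add₀ q_ne, ← zpow_add₀ q_ne, op_mul,
    show -cf a c + -cf (-a - 1) c + (cf a c + cf (-a - 1) c) = 0 by ring, zpow_zero, one_smul]

open MulOpposite in
lemma serre_wE_mul {a b : ℤ} (h : a = b + 1 ∨ b = a + 1) (c : ℤ) :
    ∃ κ : K, serre (wE a) (wE b) * wF c = κ • (wF c * serre (wE a) (wE b)) := by
  have key := mul_serre (op_wF_mul c a) (op_wF_mul c b) (op_wT_mul c a) (op_wT_mul c b)
      (fun hp => by
        have := ite_one_ne hp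
        subst this
        exact ⟨zpow_cf_self a, zpow_cf_adj h.symm⟩)
      (fun hp => by
        have := ite_one_ne hp
        subst this
        exact zpow_cf_adj h)
      (fun hp => by
        have := ite_one_ne hp
        subst this
        exact ⟨zpow_cf_self _, zpow_cf_adj (by omega)⟩)
      (fun hp => by
        have := ite_one_ne hp
        subst this
        exact zpow_cf_adj (by omega))
  have e : serre (op (wE a)) (op (wE b)) = op (serre (wE a) (wE b)) := by
    simp only [serre, ← op_mul, ← op_add, ← op_smul, ← op_sub, mul_assoc]
    rw [add_comm]
  rw [e, ← op_mul, ← op_mul, ← op_smul] at key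
  exact ⟨_, op_injective key⟩

open MulOpposite in
lemma wE_far_mul {a b : ℤ} (h : a + 1 < b ∨ b + 1 < a) (c : ℤ) :
    ∃ κ : K, (wE a * wE b - wE b * wE a) * wF c = κ • (wF c * (wE a * wE b - wE b * wE a)) := by
  have key := mul_commutator (op_wF_mul c b) (op_wF_mul c a) (op_wT_mul c b) (op_wT_mul c a)
      (fun hp => by
        have := ite_one_ne hp
        subst this
        exact zpow_cf_far h)
      (fun hp => by
        have := ite_one_ne hp
        subst this
        exact zpow_cf_far h.symm)
      (fun hp => by
        have := ite_one_ne hp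
        subst this
        exact zpow_cf_far (by omega))
      (fun hp => by
        have := ite_one_ne hp
        subst this
        exact zpow_cf_far (by omega))
  simp only [← op_mul, ← op_smul, ← op_sub] at key
  exact ⟨_, op_injective key⟩

/-- The vacuum function on words. -/
def vac : Wd := fun w => if w = [] then 1 else 0

lemma wE_vac (a : ℤ) : wE a vac = 0 := by
  ext w; simp [wE_apply, vac]

lemma wD_vac (σ : List ℤ → ℤ) (h : σ [] = 0) : wD σ vac = vac := by
  ext w
  change q ^ σ w * vac w = vac w
  by_cases hw : w = []
  · subst hw; simp [h]
  · simp [vac, hw]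

lemma wF_vac_theta (a : ℤ) : wF a vac = wF (-a - 1) vac := by
  ext w
  cases w with
  | nil => rfl
  | cons c w =>
    rw [wF_cons, wF_cons, wE_vac, map_zero, map_zero, wT, wD_vac _ (by simp [wt])]
    have h1 : (c = a) = (-c - 1 = -a - 1) := by apply propext; omega
    have h2 : (-c - 1 = a) = (c = -a - 1) := by apply propext; omega
    simp only [h1, h2]
    simp [add_comm]

/-- A word in the `F`'s applied to the vacuum. -/
def fw : List ℤ → Wd
  | [] => vac
  | a :: l => wF a (fw l)

/-- The space generated from the vacuum by the `F`'s. -/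
def Wv : Submodule K Wd := Submodule.span K (Set.range fw)

lemma fw_mem (l : List ℤ) : fw l ∈ Wv := Submodule.subset_span ⟨l, rfl⟩

lemma map_mem_Wv {f : Module.End K Wd} (h : ∀ l, f (fw l) ∈ Wv) : ∀ x ∈ Wv, f x ∈ Wv := by
  intro x hx
  have : Wv ≤ Wv.comap f := by
    rw [Wv, Submodule.span_le]
    rintro _ ⟨l, rfl⟩
    exact h l
  exact this hx

lemma eq_zero_on_Wv {f : Module.End K Wd} (h : ∀ l, f (fw l) = 0) : ∀ x ∈ Wv, f x = 0 := by
  intro x hx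
  have : Wv ≤ LinearMap.ker f := by
    rw [Wv, Submodule.span_le]
    rintro _ ⟨l, rfl⟩
    exact h l
  exact this hx

lemma wF_mem (a : ℤ) : ∀ x ∈ Wv, wF a x ∈ Wv := map_mem_Wv fun l => fw_mem (a :: l)

lemma wT_mem (a : ℤ) : ∀ x ∈ Wv, wT a x ∈ Wv := map_mem_Wv fun l => by
  induction l with
  | nil => rw [fw, wT, wD_vac _ (by simp [wt])]; exact fw_mem []
  | cons b l ih =>
    have := LinearMap.congr_fun (wT_mul_wF a b) (fw l)
    change wT a (wF b (fw l)) = (q ^ (-cf a b - cf (-a - 1) b) : K) • wF b (wT a (fw l)) at this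
    rw [fw, this]
    exact Wv.smul_mem _ (wF_mem b _ ih)

lemma wTi_mem (a : ℤ) : ∀ x ∈ Wv, wTi a x ∈ Wv := map_mem_Wv fun l => by
  induction l with
  | nil => rw [fw, wTi, wD_vac _ (by simp [wt])]; exact fw_mem []
  | cons b l ih =>
    have h := congrArg (fun x => wTi a * x * wTi a) (wT_mul_wF a b)
    simp only [mul_smul_comm, smul_mul_assoc] at h
    rw [← mul_assoc, wTi_mul_wT, one_mul, mul_assoc, mul_assoc, wT_mul_wTi, mul_one] at h
    have := LinearMap.congr_fun h (fw l)
    change wF b (wTi a (fw l)) = q ^ (-cf a b - cf (-a - 1) b) • wTi a (wF b (fw l)) at this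
    rw [fw, ← Submodule.smul_mem_iff _ (q_zpow_ne (-cf a b - cf (-a - 1) b)), ← this]
    exact wF_mem b _ ih

lemma wE_mem (a : ℤ) : ∀ x ∈ Wv, wE a x ∈ Wv := map_mem_Wv fun l => by
  induction l with
  | nil => rw [fw, wE_vac]; exact Wv.zero_mem
  | cons b l ih =>
    have := LinearMap.congr_fun (wE_mul_wF a b) (fw l)
    change wE a (wF b (fw l)) = (q ^ (-cf a b) : K) • wF b (wE a (fw l)) +
      (if a = b then 1 else 0 : K) • fw l + (if -a - 1 = b then 1 else 0 : K) • wT a (fw l) at this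
    rw [fw, this]
    exact Wv.add_mem (Wv.add_mem (Wv.smul_mem _ (wF_mem b _ ih)) (Wv.smul_mem _ (fw_mem l)))
      (Wv.smul_mem _ (wT_mem a _ (fw_mem l)))

lemma serre_wE_eq_zero {a b : ℤ} (h : a = b + 1 ∨ b = a + 1) :
    ∀ x ∈ Wv, serre (wE a) (wE b) x = 0 := eq_zero_on_Wv fun l => by
  induction l with
  | nil => simp [serre, fw, wE_vac]
  | cons c l ih =>
    obtain ⟨κ, hκ⟩ := serre_wE_mul h c
    have := LinearMap.congr_fun hκ (fw l)
    change serre (wE a) (wE b) (wF c (fw l)) = κ • wF c (serre (wE a) (wE b) (fw l)) at this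
    rw [fw, this, ih, map_zero, smul_zero]

lemma wE_far_eq_zero {a b : ℤ} (h : a + 1 < b ∨ b + 1 < a) :
    ∀ x ∈ Wv, (wE a * wE b - wE b * wE a) x = 0 := eq_zero_on_Wv fun l => by
  induction l with
  | nil => simp [fw, wE_vac]
  | cons c l ih =>
    obtain ⟨κ, hκ⟩ := wE_far_mul h c
    have := LinearMap.congr_fun hκ (fw l)
    change (wE a * wE b - wE b * wE a) (wF c (fw l)) =
      κ • wF c ((wE a * wE b - wE b * wE a) (fw l)) at this
    rw [fw, this, ih, map_zero, smul_zero]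

/-- The action of the generators on `Wv`. -/
def rep : BGen → Module.End K Wv
  | .E a => (wE a).restrict (wE_mem a)
  | .F a => (wF a).restrict (wF_mem a)
  | .T a => (wT a).restrict (wT_mem a)
  | .Tinv a => (wTi a).restrict (wTi_mem a)

lemma lift_rep_g (x : BGen) : FreeAlgebra.lift K rep (g x) = rep x := FreeAlgebra.lift_ι_apply _ _

lemma rep_rel (x y : FreeAlgebra K BGen) (h : BRel x y) :
    FreeAlgebra.lift K rep x = FreeAlgebra.lift K rep y := by
  have adj : ∀ {a b : ℤ}, |a - b| = 1 → a = b + 1 ∨ b = a + 1 := by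
    intro a b h
    rw [abs_eq (by norm_num)] at h; omega
  have far : ∀ {a b : ℤ}, 1 < |a - b| → a + 1 < b ∨ b + 1 < a := by
    intro a b h
    rw [lt_abs] at h; omega
  induction h with
  | Tcomm a b =>
    simp only [map_mul, lift_rep_g]
    exact LinearMap.ext fun ψ => Subtype.ext (LinearMap.congr_fun (wT_comm a b) ψ.1)
  | TTinv a =>
    simp only [map_mul, lift_rep_g, map_one]
    exact LinearMap.ext fun ψ => Subtype.ext (LinearMap.congr_fun (wT_mul_wTi a) ψ.1)
  | TinvT a =>
    simp only [map_mul, lift_rep_g, map_one]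
    exact LinearMap.ext fun ψ => Subtype.ext (LinearMap.congr_fun (wTi_mul_wT a) ψ.1)
  | Ttheta a =>
    simp only [lift_rep_g]
    exact LinearMap.ext fun ψ => Subtype.ext (LinearMap.congr_fun (wT_theta a) ψ.1)
  | TE a b =>
    simp only [map_mul, lift_rep_g, map_smul]
    have h : wT a * wE b * wTi a = q ^ (cf a b + cf (-a - 1) b) • wE b := by
      rw [wT_mul_wE, smul_mul_assoc, mul_assoc, wT_mul_wTi, mul_one]
    rw [cf_neg]
    exact LinearMap.ext fun ψ => Subtype.ext (LinearMap.congr_fun h ψ.1)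
  | TF a b =>
    simp only [map_mul, lift_rep_g, map_smul]
    have h : wT a * wF b * wTi a = q ^ (-(cf a b + cf (-a - 1) b)) • wF b := by
      rw [wT_mul_wF, smul_mul_assoc, mul_assoc, wT_mul_wTi, mul_one, neg_add']
    rw [cf_neg]
    exact LinearMap.ext fun ψ => Subtype.ext (LinearMap.congr_fun h ψ.1)
  | EF a b =>
    rw [map_add, map_add, map_smul, map_mul, map_mul, apply_ite (FreeAlgebra.lift K rep),
      apply_ite (FreeAlgebra.lift K rep), map_one, map_zero]
    simp only [lift_rep_g]
    have h := wE_mul_wF a b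
    refine LinearMap.ext fun ψ => Subtype.ext ((LinearMap.congr_fun h ψ.1).trans ?_)
    split_ifs <;> simp only [one_smul, zero_smul, add_zero] <;> rfl
  | Efar a b h =>
    simp only [map_mul, lift_rep_g]
    exact LinearMap.ext fun ψ => Subtype.ext (sub_eq_zero.1 (wE_far_eq_zero (far h) ψ.1 ψ.2))
  | Eserre a b h =>
    simp only [map_mul, map_add, map_smul, lift_rep_g]
    exact LinearMap.ext fun ψ => Subtype.ext (sub_eq_zero.1 (serre_wE_eq_zero (adj h) ψ.1 ψ.2))
  | Ffar a b h =>
    simp only [map_mul, lift_rep_g]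
    exact LinearMap.ext fun ψ => Subtype.ext
      (sub_eq_zero.1 (LinearMap.congr_fun (wF_far (far h)) ψ.1))
  | Fserre a b h =>
    simp only [map_mul, map_add, map_smul, lift_rep_g]
    exact LinearMap.ext fun ψ => Subtype.ext
      (sub_eq_zero.1 (LinearMap.congr_fun (serre_wF (adj h)) ψ.1))

/-- The representation of `B_θ` on `Wv`. -/
def repU : U →ₐ[K] Module.End K Wv :=
  RingQuot.liftAlgHom K ⟨FreeAlgebra.lift K rep, fun x y h => rep_rel x y h⟩

lemma repU_gen (x : BGen) : repU (RingQuot.mkAlgHom K BRel (g x)) = rep x := by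
  rw [repU, RingQuot.liftAlgHom_mkAlgHom_apply, lift_rep_g]

lemma Ee_odd (a : ℤ) : Ee (2 * a + 1) = ee a := by
  rw [Ee, ee]; congr 3; omega

lemma fgen_odd (a : ℤ) : fgen (2 * a + 1) = ff a := by
  rw [fgen, ff]; congr 3; omega

lemma Tt_odd (a : ℤ) : Tt (2 * a + 1) = tt a := by
  rw [Tt, tt]; congr 3; omega

lemma fgen_neg (a : ℤ) : fgen (-(2 * a + 1)) = ff (-a - 1) := by
  rw [← fgen_odd]; congr 1; ring

lemma phi_ne_zero : phi ≠ 0 := by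
  intro h
  rw [phi, Submodule.Quotient.mk_eq_zero] at h
  have key : ∀ x ∈ Jideal, repU x ⟨vac, fw_mem []⟩ = 0 := by
    intro x hx
    refine Submodule.span_induction ?_ ?_ ?_ ?_ hx
    · rintro _ ⟨i, ⟨a, rfl⟩, rfl | rfl | rfl⟩
      · rw [Ee_odd, ee, repU_gen]
        exact Subtype.ext (wE_vac a)
      · rw [Tt_odd, tt, map_sub, repU_gen, map_one]
        exact Subtype.ext (sub_eq_zero.2 (wD_vac _ (by simp [wt])))
      · rw [fgen_odd, fgen_neg, ff, ff, map_sub, repU_gen, repU_gen]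
        exact Subtype.ext (sub_eq_zero.2 (wF_vac_theta a))
    · simp
    · intro x y _ _ hx hy
      rw [map_add, LinearMap.add_apply, hx, hy, add_zero]
    · intro c x _ hx
      rw [smul_eq_mul, map_mul, Module.End.mul_apply, hx, map_zero]
  have := congrArg Subtype.val (key 1 h)
  rw [map_one] at this
  have := congrFun this []
  simp [vac] at this

end BTheta

namespace BTheta

section LieSegments

variable {Q : Type*} [LieRing Q] (f : ℤ → Q)

/-- Iterated brackets along a segment. -/
def lseg (a : ℤ) : ℕ → Q
  | 0 => f a
  | n + 1 => ⁅lseg a n, f (a + n + 1)⁆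

variable {f}

lemma lseg_succ (a : ℤ) (n : ℕ) : lseg f a (n + 1) = ⁅lseg f a n, f (a + n + 1)⁆ := rfl

lemma lie_lie_eq_zero {x y z : Q} (h : ⁅x, z⁆ = 0) (h' : ⁅y, z⁆ = 0) : ⁅⁅x, y⁆, z⁆ = 0 := by
  rw [lie_lie, h, h', lie_zero, lie_zero, sub_zero]

lemma lie_lie_eq_of_zero {x y z : Q} (h : ⁅x, z⁆ = 0) : ⁅⁅x, y⁆, z⁆ = ⁅x, ⁅y, z⁆⁆ := by
  rw [lie_lie, h, lie_zero, sub_zero]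

lemma lie_eq_zero_symm {x y : Q} (h : ⁅x, y⁆ = 0) : ⁅y, x⁆ = 0 := by
  rw [← lie_skew, h, neg_zero]

variable (far : ∀ a b, a + 1 < b → ⁅f a, f b⁆ = 0)
include far

lemma lseg_lie_far (a c : ℤ) (n : ℕ) (h : a + n + 1 < c ∨ c + 1 < a) : ⁅lseg f a n, f c⁆ = 0 := by
  induction n with
  | zero =>
    rcases h with h | h
    · exact far _ _ (by push_cast at h; omega)
    · exact lie_eq_zero_symm (far _ _ h)
  | succ n ih =>
    push_cast at h
    refine lie_lie_eq_zero (ih (by omega)) ?_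
    rcases h with h | h
    · exact far _ _ (by omega)
    · exact lie_eq_zero_symm (far _ _ (by omega))

lemma lseg_split (a c : ℤ) (m n : ℕ) (h : c = a + m + 1) :
    ⁅lseg f a m, lseg f c n⁆ = lseg f a (m + n + 1) := by
  induction n with
  | zero => subst h; rfl
  | succ n ih =>
    rw [lseg_succ c, ← lie_lie_eq_of_zero (lseg_lie_far far a (c + n + 1) m (by omega)), ih,
      ← add_assoc m, lseg_succ a (m + n + 1)]
    congr 2; subst h; push_cast; ring

variable (serre : ∀ a b, (a = b + 1 ∨ b = a + 1) → ⁅f a, ⁅f a, f b⁆⁆ = 0)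
  (two : ∀ x : Q, x + x = 0 → x = 0)
include serre

lemma lseg_lie_last (a c : ℤ) (n : ℕ) (h : c = a + n + 1) : ⁅lseg f a (n + 1), f c⁆ = 0 := by
  have key : ∀ b, ⁅⁅f b, f (b + 1)⁆, f (b + 1)⁆ = 0 := by
    intro b
    rw [← lie_skew, ← lie_skew (f b), lie_neg, serre _ _ (Or.inl rfl)]; simp
  subst h
  cases n with
  | zero =>
    rw [lseg_succ]
    simp only [Nat.cast_zero, add_zero]
    exact key a
  | succ n =>
    rw [← lseg_split far a (a + n + 1) n 1 rfl]
    refine lie_lie_eq_zero (lseg_lie_far far _ _ _ (by push_cast; omega)) ?_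
    have := key (a + n + 1)
    rw [lseg_succ]
    simp only [Nat.cast_zero, add_zero, Nat.cast_add, Nat.cast_one, ← add_assoc]
    exact this

lemma lseg_lie_first (a : ℤ) (n : ℕ) : ⁅lseg f a (n + 1), f a⁆ = 0 := by
  have key : ⁅lseg f a 1, f a⁆ = 0 := by
    rw [← lie_skew, lseg_succ]
    exact neg_eq_zero.2 (serre _ _ (Or.inr (by simp)))
  cases n with
  | zero => exact key
  | succ n =>
    rw [show n + 1 + 1 = 1 + n + 1 by ring, ← lseg_split far a (a + 2) 1 n (by push_cast; ring)]
    exact lie_lie_eq_zero key (lseg_lie_far far _ _ _ (by omega))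

include two

lemma lseg_two_lie (a : ℤ) : ⁅lseg f a 2, f (a + 1)⁆ = 0 := by
  set x := f a
  set y := f (a + 1)
  set w := f (a + 2)
  have hz : lseg f a 2 = ⁅⁅x, y⁆, w⁆ := by
    simp only [lseg, Nat.cast_zero, add_zero, Nat.cast_one, x, y, w, add_assoc]; norm_num
  have hxw : ⁅x, w⁆ = 0 := far _ _ (by omega)
  have h1 : ⁅⁅x, y⁆, y⁆ = 0 := by
    rw [← lie_skew, ← lie_skew x, lie_neg, serre _ _ (Or.inl rfl)]; simp
  have h2 : ⁅⁅y, w⁆, y⁆ = 0 := by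
    rw [← lie_skew, serre _ _ (Or.inr (by ring))]; simp
  have e1 : ⁅⁅⁅x, y⁆, w⁆, y⁆ = -⁅⁅x, y⁆, ⁅y, w⁆⁆ := by
    rw [lie_lie ⁅x, y⁆ w y, h1, lie_zero, sub_zero, ← lie_skew w y, lie_neg, lie_skew]
  have e2 : ⁅⁅x, y⁆, w⁆ = ⁅x, ⁅y, w⁆⁆ := by rw [lie_lie, hxw, lie_zero, sub_zero]
  have e3 : ⁅⁅x, ⁅y, w⁆⁆, y⁆ = ⁅⁅x, y⁆, ⁅y, w⁆⁆ := by
    rw [lie_lie, h2, lie_zero, zero_sub, lie_skew]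
  rw [hz]
  refine two _ ?_
  nth_rewrite 1 [e1]
  rw [e2, e3, neg_add_cancel]

lemma lseg_lie_inner (a c : ℤ) (n : ℕ) (h : a < c) (h' : c < a + n) : ⁅lseg f a n, f c⁆ = 0 := by
  have key : ∀ n : ℕ, c < a + n → a = c - 1 → ⁅lseg f a n, f c⁆ = 0 := by
    rintro n h1 rfl
    obtain ⟨n, rfl⟩ : ∃ k, n = k + 2 := ⟨n - 2, by omega⟩
    have h2 := lseg_two_lie far serre two (c - 1)
    rw [sub_add_cancel] at h2
    cases n with
    | zero => exact h2
    | succ n =>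
      rw [show n + 1 + 2 = 2 + n + 1 by ring, ← lseg_split far _ (c + 2) 2 n (by push_cast; ring)]
      exact lie_lie_eq_zero h2 (lseg_lie_far far _ _ _ (by omega))
  by_cases hc : a = c - 1
  · exact key n h' hc
  · obtain ⟨m, hm⟩ : ∃ m : ℕ, c - 1 = a + m + 1 := ⟨(c - 2 - a).toNat, by omega⟩
    obtain ⟨k, rfl⟩ : ∃ k : ℕ, n = m + (k + 2) + 1 := ⟨n - m - 3, by omega⟩
    rw [← lseg_split far a (c - 1) m (k + 2) hm]
    refine lie_lie_eq_zero (lseg_lie_far far _ _ _ (by omega)) ?_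
    have h2 := lseg_two_lie far serre two (c - 1)
    rw [sub_add_cancel] at h2
    cases k with
    | zero => exact h2
    | succ n =>
      rw [show n + 1 + 2 = 2 + n + 1 by ring, ← lseg_split far _ (c + 2) 2 n (by push_cast; ring)]
      exact lie_lie_eq_zero h2 (lseg_lie_far far _ _ _ (by omega))

lemma lseg_lie_letter (a c : ℤ) (n : ℕ) : ⁅lseg f a n, f c⁆ =
    (if a + n + 1 = c then lseg f a (n + 1) else 0) -
      (if c + 1 = a then lseg f c (n + 1) else 0) := by
  by_cases h1 : a + n + 1 = c
  · rw [if_pos h1, if_neg (by omega), sub_zero, lseg_succ, h1]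
  rw [if_neg h1, zero_sub]
  by_cases h2 : c + 1 = a
  · rw [if_pos h2, ← lie_skew, ← zero_add n, ← lseg_split far c a 0 n (by push_cast; omega)]
    simp [lseg]
  rw [if_neg h2, neg_zero]
  by_cases h3 : a + n + 1 < c ∨ c + 1 < a
  · exact lseg_lie_far far a c n h3
  cases n with
  | zero =>
    have : c = a := by push_cast at *; omega
    subst this
    exact lie_self _
  | succ n =>
    push_cast at h1 h3
    by_cases h4 : c = a + n + 1
    · exact lseg_lie_last far serre a c n h4
    by_cases h5 : c = a
    · rw [h5]; exact lseg_lie_first far serre a n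
    exact lseg_lie_inner far serre two a c (n + 1) (by omega) (by push_cast; omega)

lemma lseg_lie_lseg (a c : ℤ) (m n : ℕ) : ⁅lseg f a m, lseg f c n⁆ =
    (if a + m + 1 = c then lseg f a (m + n + 1) else 0) -
      (if c + n + 1 = a then lseg f c (m + n + 1) else 0) := by
  induction n generalizing a m with
  | zero =>
    simp only [Nat.cast_zero, add_zero]
    exact lseg_lie_letter far serre two a c m
  | succ n ih =>
    by_cases h1 : a + m + 1 = c
    · rw [if_pos h1, if_neg (by push_cast; omega), sub_zero, lseg_split far a c m (n + 1) h1.symm]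
    by_cases h2 : c + (n + 1 : ℕ) + 1 = a
    · rw [if_neg h1, if_pos h2, zero_sub, ← lie_skew, lseg_split far c a (n + 1) m (by omega)]
      congr 2; ring
    rw [if_neg h1, if_neg h2, sub_zero, lseg_succ c n, leibniz_lie, ih, if_neg h1,
      lseg_lie_letter far serre two a (c + n + 1) m, if_neg (c := c + ↑n + 1 + 1 = a)
        (by push_cast at h2; omega)]
    have e1 : ⁅(0 - if c + n + 1 = a then lseg f c (m + n + 1) else 0), f (c + n + 1)⁆ = 0 := by
      split_ifs with h
      · rw [zero_sub, neg_lie]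
        refine neg_eq_zero.2 ?_
        rw [lseg_lie_letter far serre two, if_neg (by push_cast; omega), if_neg (by omega), sub_zero]
      · simp
    have e2 : ⁅lseg f c n, (if a + m + 1 = c + n + 1 then lseg f a (m + 1) else 0) - 0⁆ = 0 := by
      split_ifs with h
      · rw [sub_zero, ← lie_skew, ih, if_neg (by push_cast; omega), if_neg (by omega), sub_zero,
          neg_zero]
      · simp
    rw [e1, e2, add_zero]

end LieSegments

end BTheta

namespace BTheta

section Rees

open scoped Pointwise

variable {R A : Type*} [CommRing R] [Ring A] [Algebra R A]

lemma mem_smul_sub {M : Type*} [AddCommGroup M] [Module R M] {ε : R} {N : Submodule R M} {x : M} :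
    x ∈ ε • N ↔ ∃ y ∈ N, ε • y = x := Submodule.mem_smul_pointwise_iff_exists _ _ _

lemma mul_mem_smul_left {ε : R} {N N' : Submodule R A} {x y : A} (hx : x ∈ ε • N) (hy : y ∈ N') :
    x * y ∈ ε • (N * N') := by
  obtain ⟨z, hz, rfl⟩ := mem_smul_sub.1 hx
  rw [smul_mul_assoc]
  exact mem_smul_sub.2 ⟨_, Submodule.mul_mem_mul hz hy, rfl⟩

lemma mul_mem_smul_right {ε : R} {N N' : Submodule R A} {x y : A} (hx : x ∈ N) (hy : y ∈ ε • N') :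
    x * y ∈ ε • (N * N') := by
  obtain ⟨z, hz, rfl⟩ := mem_smul_sub.1 hy
  rw [mul_smul_comm]
  exact mem_smul_sub.2 ⟨_, Submodule.mul_mem_mul hx hz, rfl⟩

/-- Polynomials whose `n`-th coefficient lies in `L ^ n`. -/
def reesSub (L : Submodule R A) : Subring (Polynomial A) where
  carrier := {p | ∀ n, p.coeff n ∈ L ^ n}
  mul_mem' := by
    intro p r hp hr n
    rw [Polynomial.coeff_mul]
    refine Submodule.sum_mem _ fun ij hij => ?_
    rw [← Finset.HasAntidiagonal.mem_antidiagonal.1 hij, pow_add]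
    exact Submodule.mul_mem_mul (hp _) (hr _)
  one_mem' := by
    intro n
    rw [Polynomial.coeff_one]
    split_ifs with h
    · subst h; rw [pow_zero]; exact Submodule.one_le.1 le_rfl
    · exact Submodule.zero_mem _
  add_mem' := by
    intro p r hp hr n
    rw [Polynomial.coeff_add]; exact Submodule.add_mem _ (hp n) (hr n)
  zero_mem' := by intro n; rw [Polynomial.coeff_zero]; exact Submodule.zero_mem _
  neg_mem' := by
    intro p hp n
    rw [Polynomial.coeff_neg]; exact Submodule.neg_mem _ (hp n)

/-- The multiples of `ε` in `reesSub L`. -/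
def reesIdeal (L : Submodule R A) (ε : R) : Ideal (reesSub L) where
  carrier := {p | ∀ n, p.1.coeff n ∈ ε • L ^ n}
  add_mem' := by
    intro p r hp hr n
    exact Submodule.add_mem _ (hp n) (hr n)
  zero_mem' := by intro n; exact Submodule.zero_mem _
  smul_mem' := by
    intro p r hr n
    change (p.1 * r.1).coeff n ∈ _
    rw [Polynomial.coeff_mul]
    refine Submodule.sum_mem _ fun ij hij => ?_
    rw [← Finset.HasAntidiagonal.mem_antidiagonal.1 hij, pow_add]
    exact mul_mem_smul_right (p.2 _) (hr _)

instance (L : Submodule R A) (ε : R) : (reesIdeal L ε).IsTwoSided where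
  mul_mem_of_left := by
    intro p r hp n
    change (p.1 * r.1).coeff n ∈ _
    rw [Polynomial.coeff_mul]
    refine Submodule.sum_mem _ fun ij hij => ?_
    rw [← Finset.HasAntidiagonal.mem_antidiagonal.1 hij, pow_add]
    exact mul_mem_smul_left (hp _) (r.2 _)

instance (L : Submodule R A) (ε : R) : LieRing (reesSub L ⧸ reesIdeal L ε) :=
  @LieRing.ofAssociativeRing _ (Ideal.Quotient.ring (reesIdeal L ε))

/-- The class of a homogeneous element. -/
def hcl (L : Submodule R A) (ε : R) (n : ℕ) (x : A) : reesSub L ⧸ reesIdeal L ε :=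
  if h : x ∈ L ^ n then Ideal.Quotient.mk _ ⟨Polynomial.monomial n x, fun m => by
    rw [Polynomial.coeff_monomial]
    split_ifs with hm
    · rwa [← hm]
    · exact Submodule.zero_mem _⟩ else 0

variable {L : Submodule R A} {ε : R}

lemma hcl_zero_iff {n : ℕ} {x : A} (hx : x ∈ L ^ n) : hcl L ε n x = 0 ↔ x ∈ ε • L ^ n := by
  rw [hcl, dif_pos hx, Ideal.Quotient.eq_zero_iff_mem]
  constructor
  · intro h
    simpa using h n
  · intro h m
    change (Polynomial.monomial n x).coeff m ∈ _
    rw [Polynomial.coeff_monomial]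
    split_ifs with hm
    · rwa [← hm]
    · exact Submodule.zero_mem _

lemma hcl_mul {m n : ℕ} {x y : A} (hx : x ∈ L ^ m) (hy : y ∈ L ^ n) :
    hcl L ε (m + n) (x * y) = hcl L ε m x * hcl L ε n y := by
  have hxy : x * y ∈ L ^ (m + n) := by rw [pow_add]; exact Submodule.mul_mem_mul hx hy
  rw [hcl, hcl, hcl, dif_pos hx, dif_pos hy, dif_pos hxy, ← map_mul]
  congr 1
  exact Subtype.ext (Polynomial.monomial_mul_monomial _ _ _ _).symm

lemma hcl_sub {n : ℕ} {x y : A} (hx : x ∈ L ^ n) (hy : y ∈ L ^ n) :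
    hcl L ε n (x - y) = hcl L ε n x - hcl L ε n y := by
  have hxy : x - y ∈ L ^ n := Submodule.sub_mem _ hx hy
  rw [hcl, hcl, hcl, dif_pos hx, dif_pos hy, dif_pos hxy, ← map_sub]
  congr 1
  exact Subtype.ext (map_sub _ _ _)

lemma hcl_eq_iff {n : ℕ} {x y : A} (hx : x ∈ L ^ n) (hy : y ∈ L ^ n) :
    hcl L ε n x = hcl L ε n y ↔ x - y ∈ ε • L ^ n := by
  rw [← sub_eq_zero, ← hcl_sub hx hy, hcl_zero_iff (Submodule.sub_mem _ hx hy)]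

lemma comm_mem {m n : ℕ} {x y : A} (hx : x ∈ L ^ m) (hy : y ∈ L ^ n) :
    x * y - y * x ∈ L ^ (m + n) := by
  refine Submodule.sub_mem _ ?_ ?_
  · rw [pow_add]; exact Submodule.mul_mem_mul hx hy
  · rw [add_comm, pow_add]; exact Submodule.mul_mem_mul hy hx

lemma hcl_comm {m n : ℕ} {x y : A} (hx : x ∈ L ^ m) (hy : y ∈ L ^ n) :
    hcl L ε (m + n) (x * y - y * x) = ⁅hcl L ε m x, hcl L ε n y⁆ := by
  have h1 : x * y ∈ L ^ (m + n) := by rw [pow_add]; exact Submodule.mul_mem_mul hx hy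
  have h2 : y * x ∈ L ^ (m + n) := by rw [add_comm, pow_add]; exact Submodule.mul_mem_mul hy hx
  rw [hcl_sub h1 h2, hcl_mul hx hy, add_comm m n, hcl_mul hy hx]; rfl

/-- Segments for a family `f` of letters and a parameter `t`. -/
def tseg (f : ℤ → A) (t : R) (a : ℤ) : ℕ → A
  | 0 => f a
  | n + 1 => tseg f t a n * f (a + n + 1) - t • (f (a + n + 1) * tseg f t a n)

variable {f : ℤ → A} {t : R}

lemma letter_mem (a : ℤ) : f a ∈ Submodule.span R (Set.range f) := Submodule.subset_span ⟨a, rfl⟩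

lemma letter_mem_pow (a : ℤ) : f a ∈ Submodule.span R (Set.range f) ^ 1 := by
  rw [pow_one]; exact letter_mem a

lemma tseg_mem (a : ℤ) (n : ℕ) : tseg f t a n ∈ Submodule.span R (Set.range f) ^ (n + 1) := by
  induction n with
  | zero => exact letter_mem_pow a
  | succ n ih =>
    refine Submodule.sub_mem _ ?_ (Submodule.smul_mem _ _ ?_)
    · rw [pow_succ]; exact Submodule.mul_mem_mul ih (letter_mem _)
    · rw [pow_succ']; exact Submodule.mul_mem_mul (letter_mem _) ih

lemma hcl_tseg (a : ℤ) (n : ℕ) :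
    hcl (Submodule.span R (Set.range f)) (t - 1) (n + 1) (tseg f t a n) =
      lseg (fun b => hcl (Submodule.span R (Set.range f)) (t - 1) 1 (f b)) a n := by
  induction n with
  | zero => rfl
  | succ n ih =>
    rw [lseg_succ, ← ih, ← hcl_comm (tseg_mem a n) (letter_mem_pow _), hcl_eq_iff
      (tseg_mem a (n + 1)) (comm_mem (tseg_mem a n) (letter_mem_pow _))]
    refine mem_smul_sub.2 ⟨-(f (a + n + 1) * tseg f t a n), Submodule.neg_mem _ ?_, ?_⟩
    · rw [pow_succ']; exact Submodule.mul_mem_mul (letter_mem _) (tseg_mem a n)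
    · rw [tseg]; module

/-- Modulo `t - 1`, segments multiply like matrix units. -/
lemma tseg_comm_tseg (far : ∀ a b, a + 1 < b → f a * f b = f b * f a)
    (serre : ∀ a b, (a = b + 1 ∨ b = a + 1) →
      t • (f a * f a * f b + f b * (f a * f a)) = (t * t + 1) • (f a * f b * f a))
    (half : ∃ h : R, h + h = 1) (a c : ℤ) (m n : ℕ) :
    tseg f t a m * tseg f t c n - tseg f t c n * tseg f t a m -
      ((if a + m + 1 = c then tseg f t a (m + n + 1) else 0) -
        (if c + n + 1 = a then tseg f t c (m + n + 1) else 0)) ∈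
      (t - 1) • Submodule.span R (Set.range f) ^ (m + 1 + (n + 1)) := by
  set L := Submodule.span R (Set.range f) with hL
  have e : m + 1 + (n + 1) = m + n + 1 + 1 := by ring
  have hif : ∀ (p : Prop) [Decidable p] (b : ℤ), (if p then tseg f t b (m + n + 1) else 0) ∈
      L ^ (m + 1 + (n + 1)) := by
    intro p _ b
    split_ifs
    · rw [e]; exact tseg_mem _ _
    · exact Submodule.zero_mem _
  have hz : hcl L (t - 1) (m + 1 + (n + 1)) 0 = 0 :=
    (hcl_zero_iff (Submodule.zero_mem _)).2 (Submodule.zero_mem _)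
  have hif' : ∀ (p : Prop) [Decidable p] (b : ℤ), hcl L (t - 1) (m + 1 + (n + 1))
      (if p then tseg f t b (m + n + 1) else 0) =
      if p then lseg (fun b => hcl L (t - 1) 1 (f b)) b (m + n + 1) else 0 := by
    intro p _ b
    split_ifs
    · rw [e]; exact hcl_tseg _ _
    · exact hz
  rw [← hcl_eq_iff (comm_mem (tseg_mem a m) (tseg_mem c n)) (Submodule.sub_mem _ (hif _ _) (hif _ _)),
    hcl_sub (hif _ _) (hif _ _), hif', hif', hcl_comm (tseg_mem a m) (tseg_mem c n), hcl_tseg, hcl_tseg]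
  refine lseg_lie_lseg ?_ ?_ ?_ a c m n
  · intro a b hab
    rw [← hcl_comm (letter_mem_pow a) (letter_mem_pow b), far a b hab, sub_self]
    exact (hcl_zero_iff (Submodule.zero_mem _)).2 (Submodule.zero_mem _)
  · intro a b hab
    have h1 := comm_mem (letter_mem_pow (R := R) (f := f) a) (letter_mem_pow (R := R) (f := f) b)
    rw [← hcl_comm (letter_mem_pow a) (letter_mem_pow b), ← hcl_comm (letter_mem_pow a) h1,
      hcl_zero_iff (comm_mem (letter_mem_pow a) h1)]
    have h3 : ∀ x y z, f x * f y * f z ∈ L ^ (1 + (1 + 1)) := by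
      intro x y z
      rw [← add_assoc, pow_add, pow_add]
      exact Submodule.mul_mem_mul (Submodule.mul_mem_mul (letter_mem_pow _) (letter_mem_pow _))
        (letter_mem_pow _)
    refine mem_smul_sub.2 ⟨(t - 1) • (f a * f b * f a) - (f a * f a * f b + f b * f a * f a)
      + (2 : R) • (f a * f b * f a), ?_, ?_⟩
    · exact Submodule.add_mem _ (Submodule.sub_mem _ (Submodule.smul_mem _ _ (h3 _ _ _))
        (Submodule.add_mem _ (h3 _ _ _) (h3 _ _ _))) (Submodule.smul_mem _ _ (h3 _ _ _))
    · have := serre a b hab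
      simp only [mul_sub, sub_mul, mul_assoc] at this ⊢
      linear_combination (norm := module) (-1 : R) • this
  · obtain ⟨h, hh⟩ := half
    intro x hx
    obtain ⟨p, rfl⟩ := Ideal.Quotient.mk_surjective x
    rw [← map_add, Ideal.Quotient.eq_zero_iff_mem] at hx
    rw [Ideal.Quotient.eq_zero_iff_mem]
    intro n
    have := Submodule.smul_mem _ h (hx n)
    have e2 : h • (p + p).1.coeff n = p.1.coeff n := by
      change h • (p.1 + p.1).coeff n = _
      rw [Polynomial.coeff_add, smul_add, ← add_smul, hh, one_smul]
    rwa [e2] at this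

end Rees

end BTheta

namespace BTheta

section Straightening

open scoped Pointwise

variable {R A : Type*} [CommRing R] [Ring A] [Algebra R A]

/-- The span of the letters. -/
def lspan (R : Type*) {A : Type*} [CommRing R] [Ring A] [Algebra R A] (f : ℤ → A) :
    Submodule R A := Submodule.span R (Set.range f)

variable (f : ℤ → A) (t : R) (J : Ideal A)

/-- Elements of degree `d` which vanish modulo `J` and `t - 1`. -/
def negl (d : ℕ) : Submodule R A :=
  (t - 1) • lspan R f ^ d ⊔ J.restrictScalars R

/-- The number of letters of a list of segments. -/
def deg (L : List (ℤ × ℕ)) : ℕ := (L.map fun s => s.2 + 1).sum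

/-- Products of segments. -/
def tprd (L : List (ℤ × ℕ)) : A := (L.map fun s => tseg f t s.1 s.2).prod

/-- The span of the sorted products of `θ`-restricted segments of total degree `d`. -/
def pbw (d : ℕ) : Submodule R A :=
  Submodule.span R {x | ∃ L : List (ℤ × ℕ), L.Pairwise pge ∧ (∀ s ∈ L, IsTh s) ∧ deg L = d ∧
    x = tprd f t L}

/-- What the straightening procedure reaches in degree `d`. -/
def good (d : ℕ) : Submodule R A := pbw f t d ⊔ negl f t J d

variable {f t J}

lemma deg_append (L L' : List (ℤ × ℕ)) : deg (L ++ L') = deg L + deg L' := by simp [deg]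

lemma deg_cons (s : ℤ × ℕ) (L : List (ℤ × ℕ)) : deg (s :: L) = s.2 + 1 + deg L := by simp [deg]

lemma deg_perm {L L' : List (ℤ × ℕ)} (h : L.Perm L') : deg L = deg L' := (h.map _).sum_eq

lemma tprd_append (L L' : List (ℤ × ℕ)) : tprd f t (L ++ L') = tprd f t L * tprd f t L' := by
  simp [tprd]

lemma tprd_cons (s : ℤ × ℕ) (L : List (ℤ × ℕ)) :
    tprd f t (s :: L) = tseg f t s.1 s.2 * tprd f t L := by simp [tprd]

lemma tprd_singleton (s : ℤ × ℕ) : tprd f t [s] = tseg f t s.1 s.2 := by simp [tprd]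

lemma tseg_mem_lspan (a : ℤ) (n : ℕ) : tseg f t a n ∈ lspan R f ^ (n + 1) := tseg_mem a n

lemma tprd_mem (L : List (ℤ × ℕ)) : tprd f t L ∈ lspan R f ^ deg L := by
  induction L with
  | nil => simpa [tprd, deg] using Submodule.one_le.1 (le_refl (1 : Submodule R A))
  | cons s L ih =>
    rw [tprd_cons, deg_cons, pow_add]
    exact Submodule.mul_mem_mul (tseg_mem_lspan _ _) ih

lemma smul_pow_le_negl (d : ℕ) : (t - 1) • lspan R f ^ d ≤ negl f t J d := le_sup_left

lemma ideal_mem_negl {x : A} (hx : x ∈ J) (d : ℕ) : x ∈ negl f t J d :=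
  Submodule.mem_sup_right hx

lemma negl_le_good (d : ℕ) : negl f t J d ≤ good f t J d := le_sup_right

lemma mul_mem_negl {m n : ℕ} {x y : A} (hx : x ∈ lspan R f ^ m) (hy : y ∈ negl f t J n) :
    x * y ∈ negl f t J (m + n) := by
  obtain ⟨z, hz, w, hw, rfl⟩ := Submodule.mem_sup.1 hy
  rw [mul_add]
  refine Submodule.add_mem _ (smul_pow_le_negl _ ?_) (ideal_mem_negl (J.mul_mem_left _ hw) _)
  rw [pow_add]
  exact mul_mem_smul_right hx hz

/-- If `X ≡ [x, y]` and `x ≡ x'`, `y ≡ y'` then `X ≡ [x, y'] - [y, x'] + [y', x']`. -/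
lemma comm_reflect {m n : ℕ} {X x y x' y' Z₁ Z₂ Z₃ : A} (hx : x ∈ lspan R f ^ m)
    (hy : y ∈ lspan R f ^ n) (hx' : x' ∈ lspan R f ^ m) (hy' : y' ∈ lspan R f ^ n)
    (hX : X - (x * y - y * x) ∈ negl f t J (m + n))
    (hxx : x - x' ∈ negl f t J m) (hyy : y - y' ∈ negl f t J n)
    (h1 : x * y' - y' * x - Z₁ ∈ negl f t J (m + n))
    (h2 : y * x' - x' * y - Z₂ ∈ negl f t J (m + n))
    (h3 : y' * x' - x' * y' - Z₃ ∈ negl f t J (m + n)) :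
    X - (Z₁ - Z₂ + Z₃) ∈ negl f t J (m + n) := by
  have e1 := mul_mem_negl hx hyy
  have e2 : y * (x - x') ∈ negl f t J (m + n) := add_comm n m ▸ mul_mem_negl hy hxx
  have e3 : y' * (x - x') ∈ negl f t J (m + n) := add_comm n m ▸ mul_mem_negl hy' hxx
  have e4 := mul_mem_negl hx' hyy
  have : X - (Z₁ - Z₂ + Z₃) = (X - (x * y - y * x)) + x * (y - y') - y * (x - x')
      + (x * y' - y' * x - Z₁) - (y * x' - x' * y - Z₂) + (y' * x' - x' * y' - Z₃)
      + y' * (x - x') - x' * (y - y') := by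
    noncomm_ring
  rw [this]
  exact Submodule.sub_mem _ (Submodule.add_mem _ (Submodule.add_mem _ (Submodule.sub_mem _
    (Submodule.add_mem _ (Submodule.sub_mem _ (Submodule.add_mem _ hX e1) e2) h1) h2) h3) e3) e4

/-- The relations between the letters used in the straightening procedure. -/
structure LetterRel (f : ℤ → A) (t : R) (J : Ideal A) : Prop where
  far : ∀ a b, a + 1 < b → f a * f b = f b * f a
  serre : ∀ a b, (a = b + 1 ∨ b = a + 1) →
      t • (f a * f a * f b + f b * (f a * f a)) = (t * t + 1) • (f a * f b * f a)
  half : ∃ h : R, h + h = 1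
  theta : ∀ a, f a - f (-a - 1) ∈ J

lemma LetterRel.comm (h : LetterRel f t J) (a c : ℤ) (m n : ℕ) :
    tseg f t a m * tseg f t c n - tseg f t c n * tseg f t a m -
      ((if a + m + 1 = c then tseg f t a (m + n + 1) else 0) -
        (if c + n + 1 = a then tseg f t c (m + n + 1) else 0)) ∈
      (t - 1) • lspan R f ^ (m + 1 + (n + 1)) :=
  tseg_comm_tseg h.far h.serre h.half a c m n

lemma LetterRel.flip (h : LetterRel f t J) (n : ℕ) (a : ℤ) :
    tseg f t a n - tseg f t (-a - n - 1) n ∈ negl f t J (n + 1) := by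
  induction n generalizing a with
  | zero => simpa [tseg] using ideal_mem_negl (h.theta a) 1
  | succ n ih =>
    have hl : ∀ b, f b ∈ lspan R f ^ 1 := fun b => letter_mem_pow b
    by_cases hc : a + n + 1 = -a
    · have hX := smul_pow_le_negl (J := J) _ (h.comm a (a + 1) 0 n)
      have hyy := ih (a + 1)
      have h1 := smul_pow_le_negl (J := J) _ (h.comm a (-(a + 1) - n - 1) 0 n)
      have h2 := smul_pow_le_negl (J := J) _ (h.comm (a + 1) (-a - 1) n 0)
      have h3 := smul_pow_le_negl (J := J) _ (h.comm (-(a + 1) - n - 1) (-a - 1) n 0)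
      rw [if_pos (by push_cast; ring), if_neg (by omega), sub_zero] at hX
      rw [if_neg (by omega), if_neg (by omega), sub_zero] at h1
      rw [if_neg (by omega), if_neg (by push_cast; omega), sub_zero] at h2
      rw [if_pos (by ring), if_neg (by push_cast; omega), sub_zero] at h3
      rw [show n + 1 + (0 + 1) = 0 + 1 + (n + 1) by ring] at h2 h3
      have key := comm_reflect (x := tseg f t a 0) (x' := tseg f t (-a - 1) 0)
        (tseg_mem_lspan a 0) (tseg_mem_lspan (a + 1) n)
        (tseg_mem_lspan (-a - 1) 0) (tseg_mem_lspan (-(a + 1) - n - 1) n)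
        (X := tseg f t a (0 + n + 1)) (by rw [← neg_sub]; exact Submodule.neg_mem _ hX)
        (ideal_mem_negl (h.theta a) _) hyy h1 h2 h3
      rw [show 0 + n + 1 = n + 1 by ring, show 0 + 1 + (n + 1) = n + 1 + 1 by ring] at key
      rw [show -a - ((n + 1 : ℕ) : ℤ) - 1 = -(a + 1) - n - 1 by push_cast; ring]
      simpa using key
    · have hX := smul_pow_le_negl (J := J) _ (h.comm a (a + n + 1) n 0)
      have hxx := ih a
      have h1 := smul_pow_le_negl (J := J) _ (h.comm a (-(a + n + 1) - 1) n 0)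
      have h2 := smul_pow_le_negl (J := J) _ (h.comm (a + n + 1) (-a - n - 1) 0 n)
      have h3 := smul_pow_le_negl (J := J) _ (h.comm (-(a + n + 1) - 1) (-a - n - 1) 0 n)
      rw [if_pos rfl, if_neg (by push_cast; omega), sub_zero] at hX
      rw [if_neg (by omega), if_neg (by push_cast; omega), sub_zero] at h1
      rw [if_neg (by push_cast; omega), if_neg (by omega), sub_zero] at h2
      rw [if_pos (by push_cast; ring), if_neg (by omega), sub_zero] at h3
      rw [show 0 + 1 + (n + 1) = n + 1 + (0 + 1) by ring] at h2 h3
      have key := comm_reflect (y := tseg f t (a + n + 1) 0) (y' := tseg f t (-(a + n + 1) - 1) 0)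
        (tseg_mem_lspan a n) (tseg_mem_lspan (a + n + 1) 0)
        (tseg_mem_lspan (-a - n - 1) n) (tseg_mem_lspan (-(a + n + 1) - 1) 0)
        (X := tseg f t a (n + 0 + 1)) (by rw [← neg_sub]; exact Submodule.neg_mem _ hX)
        hxx (ideal_mem_negl (h.theta _) _) h1 h2 h3
      rw [show 0 + n + 1 = n + 1 by ring] at key
      rw [show -a - ((n + 1 : ℕ) : ℤ) - 1 = -(a + n + 1) - 1 by push_cast; ring]
      simpa using key

/-- The `θ`-restricted representative of a segment. -/
def thRep (s : ℤ × ℕ) : ℤ × ℕ := if IsTh s then s else (-s.1 - s.2 - 1, s.2)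

lemma isTh_thRep (s : ℤ × ℕ) : IsTh (thRep s) := by
  unfold thRep
  split_ifs with hs
  · exact hs
  · simp only [IsTh] at hs ⊢; omega

lemma thRep_snd (s : ℤ × ℕ) : (thRep s).2 = s.2 := by
  unfold thRep
  split_ifs <;> rfl

lemma LetterRel.thRep (h : LetterRel f t J) (s : ℤ × ℕ) :
    tseg f t s.1 s.2 - tseg f t (thRep s).1 (thRep s).2 ∈ negl f t J (s.2 + 1) := by
  unfold BTheta.thRep
  split_ifs
  · simp
  · exact h.flip s.2 s.1

lemma LetterRel.perm (h : LetterRel f t J) {L L' : List (ℤ × ℕ)} (hp : L.Perm L') :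
    ∀ P : List (ℤ × ℕ), (∀ Q : List (ℤ × ℕ), Q.length < (P ++ L).length →
      tprd f t Q ∈ good f t J (deg Q)) →
    tprd f t (P ++ L) - tprd f t (P ++ L') ∈ good f t J (deg (P ++ L)) := by
  induction hp with
  | nil => intro P _; simp
  | @cons x L L' hp ih =>
    intro P hQ
    have := ih (P ++ [x]) (by simpa using hQ)
    simpa using this
  | @swap x y l =>
    intro P hQ
    have hc := h.comm y.1 x.1 y.2 x.2
    have hite : ∀ (p : Prop) [Decidable p] (b : ℤ),
        tprd f t P * ((if p then tseg f t b (y.2 + x.2 + 1) else 0) * tprd f t l) ∈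
          good f t J (deg (P ++ y :: x :: l)) := by
      intro p _ b
      split_ifs
      · have := hQ (P ++ (b, y.2 + x.2 + 1) :: l) (by simp)
        rw [tprd_append, tprd_cons] at this
        convert this using 2
        simp only [deg_append, deg_cons]; ring
      · simp
    have herr : tprd f t P * ((tseg f t y.1 y.2 * tseg f t x.1 x.2
        - tseg f t x.1 x.2 * tseg f t y.1 y.2 -
      ((if y.1 + y.2 + 1 = x.1 then tseg f t y.1 (y.2 + x.2 + 1) else 0) -
        (if x.1 + x.2 + 1 = y.1 then tseg f t x.1 (y.2 + x.2 + 1) else 0))) * tprd f t l) ∈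
        good f t J (deg (P ++ y :: x :: l)) := by
      have h1 := mul_mem_smul_left hc (tprd_mem (R := R) (f := f) (t := t) l)
      have h2 := mul_mem_smul_right (tprd_mem (R := R) (f := f) (t := t) P) h1
      rw [← pow_add, ← pow_add] at h2
      rw [show deg (P ++ y :: x :: l) = deg P + (y.2 + 1 + (x.2 + 1) + deg l) by
        simp only [deg_append, deg_cons]; ring]
      exact negl_le_good _ (smul_pow_le_negl _ h2)
    have hsum := Submodule.add_mem _ herr (Submodule.sub_mem _ (hite (y.1 + y.2 + 1 = x.1) y.1)
      (hite (x.1 + x.2 + 1 = y.1) x.1))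
    convert hsum using 1
    simp only [tprd_append, tprd_cons]
    noncomm_ring
  | @trans L₁ L₂ L₃ h1 _ ih1 ih2 =>
    intro P hQ
    have e1 := ih1 P hQ
    have e2 := ih2 P (by
      intro Q hl
      exact hQ Q (by simpa [h1.length_eq] using hl))
    have hd : deg (P ++ L₁) = deg (P ++ L₂) := by rw [deg_append, deg_append, deg_perm h1]
    rw [← hd] at e2
    simpa using Submodule.add_mem _ e1 e2

lemma LetterRel.tprd_good (h : LetterRel f t J) (r : ℕ) :
    ∀ L : List (ℤ × ℕ), L.length = r → tprd f t L ∈ good f t J (deg L) := by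
  induction r using Nat.strong_induction_on with
  | _ r ihr =>
    have hP : ∀ {L L' : List (ℤ × ℕ)}, L.length = r → L.Perm L' →
        tprd f t L' ∈ good f t J (deg L') → tprd f t L ∈ good f t J (deg L) := by
      intro L L' hL hp hg
      have := h.perm hp [] fun Q hQ => ihr Q.length (by simpa [hL] using hQ) Q rfl
      rw [← deg_perm hp] at hg
      simpa using Submodule.add_mem _ this hg
    have inner : ∀ L L' : List (ℤ × ℕ), (L ++ L').length = r → (∀ s ∈ L', IsTh s) →
        tprd f t (L ++ L') ∈ good f t J (deg (L ++ L')) := by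
      intro L
      induction L with
      | nil =>
        intro L' hL hth
        have hp := List.mergeSort_perm L' (fun s t => decide (pge s t))
        refine hP (L' := L'.mergeSort (fun s t => decide (pge s t))) (by simpa using hL)
          hp.symm (Submodule.mem_sup_left (Submodule.subset_span
            ⟨_, ?_, fun s hs => hth s (hp.mem_iff.1 hs), rfl, rfl⟩))
        have := List.pairwise_mergeSort (le := fun s t => decide (pge s t))
          (by intro a b c; rw [decide_eq_true_eq, decide_eq_true_eq, decide_eq_true_eq]
              simp only [pge]; omega)
          (by intro a b; rw [Bool.or_eq_true, decide_eq_true_eq, decide_eq_true_eq]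
              simp only [pge]; omega) L'
        simpa using this
      | cons s L ih =>
        intro L' hL hth
        have hp1 : ((s :: L) ++ L').Perm ((L ++ L') ++ [s]) := by
          rw [List.cons_append]
          exact (List.perm_append_singleton s (L ++ L')).symm
        have hp2 : ((L ++ L') ++ [BTheta.thRep s]).Perm (L ++ (BTheta.thRep s :: L')) := by
          rw [List.append_assoc]
          exact (List.perm_append_singleton _ _).append_left L
        have hlen : (L ++ BTheta.thRep s :: L').length = r := by
          rw [← hL]; simp; ring
        have g1 := ih (BTheta.thRep s :: L') hlen (by
          intro u hu
          rcases List.mem_cons.1 hu with rfl | hu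
          · exact isTh_thRep s
          · exact hth u hu)
        have g2 := hP (by rw [hp2.length_eq, hlen]) hp2 g1
        refine hP hL hp1 ?_
        have g3 := mul_mem_negl (tprd_mem (R := R) (f := f) (t := t) (L ++ L')) (h.thRep s)
        have hd : deg (L ++ L' ++ [s]) = deg (L ++ L') + (s.2 + 1) := by
          rw [deg_append]; simp [deg]
        have hd' : deg (L ++ L' ++ [BTheta.thRep s]) = deg (L ++ L') + (s.2 + 1) := by
          rw [deg_append]; simp [deg, thRep_snd]
        rw [hd'] at g2
        rw [hd]
        rw [tprd_append, tprd_singleton] at g2 ⊢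
        simpa [mul_sub] using Submodule.add_mem _ (negl_le_good _ g3) g2
    intro L hL
    simpa using inner L [] (by simpa using hL) (by simp)

lemma lspan_pow_le (d : ℕ) : lspan R f ^ d ≤
    Submodule.span R {x | ∃ L : List (ℤ × ℕ), deg L = d ∧ x = tprd f t L} := by
  induction d with
  | zero =>
    rw [pow_zero, Submodule.one_eq_span, Submodule.span_le]
    rintro _ rfl
    exact Submodule.subset_span ⟨[], rfl, rfl⟩
  | succ d ih =>
    rw [pow_succ']
    refine (mul_le_mul' le_rfl ih).trans ?_
    rw [lspan, Submodule.span_mul_span, Submodule.span_le]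
    rintro _ ⟨_, ⟨a, rfl⟩, _, ⟨L, hL, rfl⟩, rfl⟩
    refine Submodule.subset_span ⟨(a, 0) :: L, ?_, ?_⟩
    · rw [deg_cons, hL]; ring
    · rw [tprd_cons]; rfl

/-- Straightening up to a denominator which is invertible at `t = 1`. -/
lemma LetterRel.exists_denominator (h : LetterRel f t J) (hf : (Set.range f).Finite) (d : ℕ) :
    ∃ r : R, r - 1 ∈ Ideal.span {t - 1} ∧
      ∀ x ∈ lspan R f ^ d, r • x ∈ pbw f t d ⊔ J.restrictScalars R := by
  have hle : lspan R f ^ d ≤ (pbw f t d ⊔ J.restrictScalars R) ⊔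
      Ideal.span {t - 1} • lspan R f ^ d := by
    refine (lspan_pow_le (t := t) d).trans ?_
    rw [Submodule.span_le]
    rintro _ ⟨L, rfl, rfl⟩
    have := h.tprd_good _ L rfl
    rw [Submodule.ideal_span_singleton_smul, sup_assoc, sup_comm (J.restrictScalars R)]
    exact this
  have hfg : (lspan R f ^ d).FG := (Submodule.fg_span hf).pow d
  obtain ⟨r, hr, hr'⟩ :=
    Submodule.exists_sub_one_mem_and_smul_le_of_fg_of_le_sup hfg le_rfl hle
  exact ⟨r, hr, fun x hx => hr' (Submodule.smul_mem_pointwise_smul x r _ hx)⟩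

end Straightening

end BTheta

namespace BTheta

section Spanning

open Polynomial

/-- Letters outside of the window `[-N-1, N]` are replaced by zero. -/
def fcut (N : ℕ) (a : ℤ) : U := if -(N : ℤ) - 1 ≤ a ∧ a ≤ N then ff a else 0

lemma fcut_eq {N : ℕ} {a : ℤ} (h : -(N : ℤ) - 1 ≤ a ∧ a ≤ N) : fcut N a = ff a := if_pos h

lemma fcut_eq_zero {N : ℕ} {a : ℤ} (h : ¬(-(N : ℤ) - 1 ≤ a ∧ a ≤ N)) : fcut N a = 0 := if_neg h

lemma poly_smul_eq (p : ℚ[X]) (x : U) : p • x = (algebraMap ℚ[X] K p) • x :=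
  algebra_compatible_smul K p x

lemma finite_range_fcut (N : ℕ) : (Set.range (fcut N)).Finite := by
  refine ((Set.finite_Icc (-(N : ℤ) - 1) N).image ff |>.union (Set.finite_singleton 0)).subset ?_
  rintro _ ⟨a, rfl⟩
  by_cases h : -(N : ℤ) - 1 ≤ a ∧ a ≤ N
  · exact Or.inl ⟨a, h, (fcut_eq h).symm⟩
  · exact Or.inr (fcut_eq_zero h)

lemma ff_sub_mem (a : ℤ) : ff a - ff (-a - 1) ∈ Jideal := by
  refine Ideal.subset_span ⟨2 * a + 1, ⟨a, rfl⟩, Or.inr (Or.inr ?_)⟩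
  rw [fgen_odd, fgen_neg]

lemma ee_mem (a : ℤ) : ee a ∈ Jideal :=
  Ideal.subset_span ⟨2 * a + 1, ⟨a, rfl⟩, Or.inl (Ee_odd a).symm⟩

lemma tt_sub_one_mem (a : ℤ) : tt a - 1 ∈ Jideal :=
  Ideal.subset_span ⟨2 * a + 1, ⟨a, rfl⟩, Or.inr (Or.inl (by rw [Tt_odd]))⟩

lemma letterRel_fcut (N : ℕ) : LetterRel (fcut N) (X : ℚ[X]) Jideal where
  far a b h := by
    unfold fcut
    split_ifs
    · exact ff_far (Or.inl h)
    all_goals simp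
  serre a b h := by
    by_cases ha : -(N : ℤ) - 1 ≤ a ∧ a ≤ N
    · by_cases hb : -(N : ℤ) - 1 ≤ b ∧ b ≤ N
      · have key := congrArg (fun x => q • x) (ff_serre h)
        rw [fcut_eq ha, fcut_eq hb, poly_smul_eq, poly_smul_eq, map_add, map_mul, map_one, ← q_eq, key,
          smul_smul, mul_add, mul_inv_cancel₀ q_ne]
      · simp [fcut_eq_zero hb]
    · simp [fcut_eq_zero ha]
  half := ⟨C (1 / 2), by rw [← C_add]; norm_num⟩
  theta a := by
    by_cases ha : -(N : ℤ) - 1 ≤ a ∧ a ≤ N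
    · rw [fcut_eq ha, fcut_eq (by omega)]; exact ff_sub_mem a
    · rw [fcut_eq_zero ha, fcut_eq_zero (by omega), sub_zero]; exact Submodule.zero_mem _

lemma tseg_fcut (N : ℕ) (a : ℤ) (n : ℕ) :
    tseg (fcut N) (X : ℚ[X]) a n = sgm a n ∨ tseg (fcut N) (X : ℚ[X]) a n = 0 := by
  induction n with
  | zero =>
    by_cases ha : -(N : ℤ) - 1 ≤ a ∧ a ≤ N
    · exact Or.inl (fcut_eq ha)
    · exact Or.inr (fcut_eq_zero ha)
  | succ n ih =>
    rw [tseg, sgm]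
    rcases ih with ih | ih
    · by_cases ha : -(N : ℤ) - 1 ≤ a + n + 1 ∧ a + n + 1 ≤ N
      · left; rw [ih, fcut_eq ha, poly_smul_eq, ← q_eq]
      · right; rw [fcut_eq_zero ha]; simp
    · right; rw [ih]; simp

lemma tprd_fcut (N : ℕ) (L : List (ℤ × ℕ)) :
    tprd (fcut N) (X : ℚ[X]) L = prd L ∨ tprd (fcut N) (X : ℚ[X]) L = 0 := by
  induction L with
  | nil => left; rfl
  | cons s L ih =>
    rw [tprd_cons, prd_cons]
    rcases ih with ih | ih
    · rcases tseg_fcut N s.1 s.2 with h | h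
      · left; rw [ih, h]
      · right; rw [h, zero_mul]
    · right; rw [ih, mul_zero]

/-- The span of the PBW products, modulo the ideal defining `Vt`. -/
def pbwK : Submodule K U :=
  Submodule.span K {x | ∃ L : List (ℤ × ℕ), L.Pairwise pge ∧ (∀ s ∈ L, IsTh s) ∧ x = prd L} ⊔
    Jideal.restrictScalars K

lemma word_mem_pbwK (w : List ℤ) : (w.map ff).prod ∈ pbwK := by
  obtain ⟨N, hN⟩ : ∃ N : ℕ, ∀ a ∈ w, -(N : ℤ) - 1 ≤ a ∧ a ≤ N := by
    induction w with
    | nil => exact ⟨0, by simp⟩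
    | cons a w ih =>
      obtain ⟨N, hN⟩ := ih
      refine ⟨N + a.natAbs, fun b hb => ?_⟩
      rcases List.mem_cons.1 hb with rfl | hb
      · omega
      · have := hN b hb; omega
  obtain ⟨r, hr, hr'⟩ := (letterRel_fcut N).exists_denominator (finite_range_fcut N) w.length
  have hw : (w.map ff).prod ∈ lspan ℚ[X] (fcut N) ^ w.length := by
    clear hr hr'
    induction w with
    | nil => simpa using Submodule.one_le.1 (le_refl (1 : Submodule ℚ[X] U))
    | cons a w ih =>
      rw [List.map_cons, List.prod_cons, List.length_cons, pow_succ']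
      refine Submodule.mul_mem_mul ?_ (ih fun b hb => hN b (by simp [hb]))
      rw [← fcut_eq (hN a (by simp))]
      exact Submodule.subset_span ⟨a, rfl⟩
  have h0 : algebraMap ℚ[X] K r ≠ 0 := by
    intro h
    have hr0 : r = 0 := by
      apply RatFunc.algebraMap_injective ℚ
      rw [h, map_zero]
    rw [hr0, Ideal.mem_span_singleton] at hr
    obtain ⟨p, hp⟩ := hr
    have := congrArg (eval 1) hp
    simp at this
  have hle : pbw (fcut N) (X : ℚ[X]) w.length ⊔ Jideal.restrictScalars ℚ[X] ≤
      pbwK.restrictScalars ℚ[X] := by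
    refine sup_le ?_ fun x hx => Submodule.mem_sup_right hx
    rw [pbw, Submodule.span_le]
    rintro _ ⟨L, h1, h2, -, rfl⟩
    rcases tprd_fcut N L with h | h
    · rw [h]; exact Submodule.mem_sup_left (Submodule.subset_span ⟨L, h1, h2, rfl⟩)
    · rw [h]; exact Submodule.zero_mem _
  have := hle (hr' _ hw)
  rw [poly_smul_eq, Submodule.restrictScalars_mem] at this
  exact (Submodule.smul_mem_iff _ h0).1 this

/-- The span of the words in the letters `ff a`, modulo the ideal defining `Vt`. -/
def wordK : Submodule K U :=
  Submodule.span K (Set.range fun w : List ℤ => (w.map ff).prod) ⊔ Jideal.restrictScalars K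

lemma word_mem_wordK (w : List ℤ) : (w.map ff).prod ∈ wordK :=
  Submodule.mem_sup_left (Submodule.subset_span ⟨w, rfl⟩)

lemma ideal_mem_wordK {x : U} (hx : x ∈ Jideal) : x ∈ wordK := Submodule.mem_sup_right hx

lemma mul_mem_wordK {u : U} (hu : ∀ w : List ℤ, u * (w.map ff).prod ∈ wordK) {x : U}
    (hx : x ∈ wordK) : u * x ∈ wordK := by
  have : wordK ≤ wordK.comap (LinearMap.mulLeft K u) := by
    refine sup_le ?_ fun x hx => ideal_mem_wordK (Jideal.mul_mem_left u hx)
    rw [Submodule.span_le]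
    rintro _ ⟨w, rfl⟩
    exact hu w
  exact this hx

lemma ff_mul_mem (a : ℤ) {x : U} (hx : x ∈ wordK) : ff a * x ∈ wordK :=
  mul_mem_wordK (fun w => by simpa using word_mem_wordK (a :: w)) hx

lemma tt_mul_mem (a : ℤ) {x : U} (hx : x ∈ wordK) : tt a * x ∈ wordK := by
  refine mul_mem_wordK (fun w => ?_) hx
  induction w with
  | nil =>
    have h := Submodule.add_mem _ (ideal_mem_wordK (tt_sub_one_mem a)) (word_mem_wordK [])
    simpa using h
  | cons b w ih =>
    rw [List.map_cons, List.prod_cons, ← mul_assoc, tt_mul_ff, smul_mul_assoc, mul_assoc]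
    exact Submodule.smul_mem _ _ (ff_mul_mem b ih)

lemma ti_mul_ff (a b : ℤ) : ∃ c : K, ti a * ff b = c • (ff b * ti a) := by
  refine ⟨(q ^ (-cf a b - cf (-a - 1) b))⁻¹, ?_⟩
  have h := congrArg (fun x => ti a * x * ti a) (tt_mul_ff a b)
  simp only [mul_smul_comm, smul_mul_assoc] at h
  rw [← mul_assoc, ti_mul_tt, one_mul, mul_assoc (ti a), mul_assoc (ff b), tt_mul_ti, mul_one] at h
  rw [h, smul_smul, inv_mul_cancel₀ (q_zpow_ne _), one_smul]

lemma ti_mul_mem (a : ℤ) {x : U} (hx : x ∈ wordK) : ti a * x ∈ wordK := by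
  refine mul_mem_wordK (fun w => ?_) hx
  induction w with
  | nil =>
    have h := Submodule.sub_mem _ (word_mem_wordK [])
      (ideal_mem_wordK (Jideal.mul_mem_left (ti a) (tt_sub_one_mem a)))
    simpa [mul_sub, ti_mul_tt] using h
  | cons b w ih =>
    obtain ⟨c, hc⟩ := ti_mul_ff a b
    rw [List.map_cons, List.prod_cons, ← mul_assoc, hc, smul_mul_assoc, mul_assoc]
    exact Submodule.smul_mem _ _ (ff_mul_mem b ih)

lemma ee_mul_mem (a : ℤ) {x : U} (hx : x ∈ wordK) : ee a * x ∈ wordK := by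
  refine mul_mem_wordK (fun w => ?_) hx
  induction w with
  | nil => simpa using ideal_mem_wordK (ee_mem a)
  | cons b w ih =>
    rw [List.map_cons, List.prod_cons, ← mul_assoc, ee_mul_ff, add_mul, add_mul, smul_mul_assoc,
      mul_assoc]
    refine Submodule.add_mem _ (Submodule.add_mem _ (Submodule.smul_mem _ _ (ff_mul_mem b ih)) ?_) ?_
    · split_ifs
      · simpa using word_mem_wordK w
      · simp
    · split_ifs
      · exact tt_mul_mem a (word_mem_wordK w)
      · simp

lemma wordK_eq_top : wordK = ⊤ := by
  rw [eq_top_iff]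
  rintro u -
  obtain ⟨z, rfl⟩ := RingQuot.mkAlgHom_surjective K BRel u
  suffices h : ∀ x ∈ wordK, RingQuot.mkAlgHom K BRel z * x ∈ wordK by
    simpa using h 1 (by simpa using word_mem_wordK [])
  induction z using FreeAlgebra.induction with
  | grade0 c =>
    intro x hx
    rw [AlgHom.commutes, ← Algebra.smul_def]
    exact Submodule.smul_mem _ _ hx
  | grade1 y =>
    intro x hx
    rcases y with a | a | a | a
    · exact ee_mul_mem a hx
    · exact ff_mul_mem a hx
    · exact tt_mul_mem a hx
    · exact ti_mul_mem a hx
  | mul y z hy hz =>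
    intro x hx
    rw [map_mul, mul_assoc]
    exact hy _ (hz _ hx)
  | add y z hy hz =>
    intro x hx
    rw [map_add, add_mul]
    exact Submodule.add_mem _ (hy _ hx) (hz _ hx)

lemma pbwK_eq_top : pbwK = ⊤ := by
  rw [eq_top_iff, ← wordK_eq_top]
  refine sup_le ?_ fun x hx => Submodule.mem_sup_right hx
  rw [Submodule.span_le]
  rintro _ ⟨w, rfl⟩
  exact word_mem_pbwK w

end Spanning

end BTheta

namespace BTheta

section Multisegments

lemma qint_ne_zero {k : ℤ} (hk : 0 < k) : qint k ≠ 0 := by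
  have h : ∀ {k : ℤ}, 0 < k → q ^ k - q ^ (-k) ≠ 0 := by
    intro k hk h
    rw [sub_eq_zero] at h
    have h2 : q ^ (k + k).toNat = 1 := by
      rw [← zpow_natCast, Int.toNat_of_nonneg (by omega), zpow_add₀ q_ne]
      nth_rw 1 [h]
      rw [← zpow_add₀ q_ne, neg_add_cancel, zpow_zero]
    exact q_pow_ne_one _ (by omega) h2
  rw [qint]
  refine div_ne_zero (h hk) ?_
  simpa using h one_pos

lemma segAux_odd (a : ℤ) (n : ℕ) : segAux (2 * a + 1) n = sgm a n := by
  induction n with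
  | zero => exact fgen_odd a
  | succ n ih =>
    rw [segAux, sgm, ih, show 2 * a + 1 + 2 * ((n : ℤ) + 1) = 2 * (a + n + 1) + 1 by ring, fgen_odd]

/-- The index of the first letter and the length of the segment with given end points. -/
def dec (p : ℤ × ℤ) : ℤ × ℕ := ((p.1 - 1) / 2, ((p.2 - p.1) / 2).toNat)

/-- The end points of a segment. -/
def enc (s : ℤ × ℕ) : ℤ × ℤ := (2 * s.1 + 1, 2 * (s.1 + s.2) + 1)

lemma enc_injective : Function.Injective enc := by
  rintro ⟨a, n⟩ ⟨b, m⟩ h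
  simp only [enc, Prod.mk.injEq] at h ⊢
  omega

lemma enc_dec {p : ℤ × ℤ} (h1 : Odd p.1) (h2 : Odd p.2) (h : p.1 ≤ p.2) : enc (dec p) = p := by
  obtain ⟨i, j⟩ := p
  obtain ⟨a, ha⟩ := h1
  obtain ⟨b, hb⟩ := h2
  simp only at ha hb h
  simp only [enc, dec, Prod.mk.injEq]
  omega

lemma seg_eq {p : ℤ × ℤ} (h1 : Odd p.1) : seg p.1 p.2 = sgm (dec p).1 (dec p).2 := by
  obtain ⟨i, j⟩ := p
  obtain ⟨a, rfl⟩ := h1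
  rw [seg, segAux_odd]
  congr 1
  simp only [dec]; omega

lemma exists_segPowM (i j : ℤ) {n : ℤ} (hn : 0 ≤ n) :
    ∃ c : K, c ≠ 0 ∧ segPowM i j n = c • seg i j ^ n.toNat := by
  unfold segPowM segPow
  split_ifs
  · omega
  · exact ⟨_, inv_ne_zero (Finset.prod_ne_zero_iff.2 fun ν _ => qint_ne_zero (by omega)), rfl⟩
  · omega
  · exact ⟨_, inv_ne_zero (Finset.prod_ne_zero_iff.2 fun ν _ => qint_ne_zero (by omega)), rfl⟩

/-- The segments of `m` in decreasing order, with multiplicities. -/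
def mlist (m : MS) : List (ℤ × ℕ) :=
  (box (bound m)).flatMap fun p => List.replicate (m p).toNat (dec p)

/-- The multisegment of a list of segments. -/
def msum (L : List (ℤ × ℕ)) : MS := (L.map fun s => Finsupp.single (enc s) 1).sum

lemma exists_PthetaProd {m : MS} (hm : IsTheta m) :
    ∃ c : K, c ≠ 0 ∧ PthetaProd m = c • prd (mlist m) := by
  unfold PthetaProd mlist
  induction box (bound m) with
  | nil => exact ⟨1, one_ne_zero, by simp [prd]⟩
  | cons p B ih =>
    obtain ⟨c, hc, h⟩ := ih
    have h0 : 0 ≤ m p := by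
      by_cases h : m p = 0
      · exact h.ge
      · exact (hm p.1 p.2 h).2.2.2.2.le
    obtain ⟨d, hd, h'⟩ := exists_segPowM p.1 p.2 h0
    refine ⟨d * c, mul_ne_zero hd hc, ?_⟩
    have hrep : prd (List.replicate (m p).toNat (dec p)) = seg p.1 p.2 ^ (m p).toNat := by
      by_cases h : m p = 0
      · simp [h, prd]
      · rw [prd, List.map_replicate, List.prod_replicate, seg_eq (hm p.1 p.2 h).1]
    rw [List.map_cons, List.prod_cons, h, h', List.flatMap_cons, prd_append, hrep, smul_mul_smul_comm]

lemma box_eq (N : ℕ) : box N = (List.range (2 * N + 1)).flatMap fun a : ℕ =>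
    (List.range (2 * N + 1)).map fun b : ℕ => ((N : ℤ) - (b : ℤ), (N : ℤ) - (a : ℤ)) := by
  simp only [box, List.bind_eq_flatMap, List.pure_def, List.flatMap_assoc, List.flatMap_singleton,
    List.map_eq_flatMap]

lemma box_pairwise (N : ℕ) : (box N).Pairwise fun p p' => p'.2 < p.2 ∨ (p'.2 = p.2 ∧ p'.1 < p.1) := by
  rw [box_eq]
  rw [List.pairwise_flatMap]
  constructor
  · intro a _
    rw [List.pairwise_map]
    refine List.pairwise_lt_range.imp fun h => ?_
    right; refine ⟨rfl, ?_⟩; simp only; omega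
  · refine List.pairwise_lt_range.imp fun h => ?_
    intro x hx y hy
    obtain ⟨b, _, rfl⟩ := List.mem_map.1 hx
    obtain ⟨c, _, rfl⟩ := List.mem_map.1 hy
    left; simp only; omega

lemma box_nodup (N : ℕ) : (box N).Nodup := by
  refine (box_pairwise N).imp fun h => ?_
  rintro rfl
  omega

lemma mem_box {N : ℕ} {p : ℤ × ℤ} (h1 : p.1.natAbs ≤ N) (h2 : p.2.natAbs ≤ N) : p ∈ box N := by
  rw [box_eq]
  rw [List.mem_flatMap]
  refine ⟨((N : ℤ) - p.2).toNat, List.mem_range.2 (by omega), List.mem_map.2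
    ⟨((N : ℤ) - p.1).toNat, List.mem_range.2 (by omega), ?_⟩⟩
  ext <;> simp only <;> omega

lemma isTh_mlist {m : MS} (hm : IsTheta m) : ∀ s ∈ mlist m, IsTh s := by
  intro s hs
  obtain ⟨p, _, hp⟩ := List.mem_flatMap.1 hs
  obtain ⟨h0, rfl⟩ := List.mem_replicate.1 hp
  obtain ⟨⟨a, ha⟩, ⟨b, hb⟩, h3, h4, -⟩ := hm p.1 p.2 (by rintro h; exact h0 (by rw [Prod.mk.eta] at h; rw [h]; rfl))
  simp only [IsTh, dec]; omega

lemma pairwise_mlist {m : MS} (hm : IsTheta m) : (mlist m).Pairwise pge := by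
  unfold mlist
  rw [List.pairwise_flatMap]
  refine ⟨fun p _ => List.pairwise_replicate.2 (Or.inr (Or.inr ⟨rfl, le_rfl⟩)),
    (box_pairwise _).imp fun {p p'} h s hs s' hs' => ?_⟩
  obtain ⟨h0, rfl⟩ := List.mem_replicate.1 hs
  obtain ⟨h0', rfl⟩ := List.mem_replicate.1 hs'
  obtain ⟨⟨a, ha⟩, ⟨b, hb⟩, h3, h4, -⟩ := hm p.1 p.2 (by rintro h; exact h0 (by rw [Prod.mk.eta] at h; rw [h]; rfl))
  obtain ⟨⟨a', ha'⟩, ⟨b', hb'⟩, h3', h4', -⟩ := hm p'.1 p'.2 (by rintro h; exact h0' (by rw [Prod.mk.eta] at h; rw [h]; rfl))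
  simp only [pge, dec]; omega

lemma msum_append (L L' : List (ℤ × ℕ)) : msum (L ++ L') = msum L + msum L' := by simp [msum]

lemma msum_mlist {m : MS} (hm : IsTheta m) : msum (mlist m) = m := by
  have h1 : ∀ B : List (ℤ × ℤ), msum (B.flatMap fun p => List.replicate (m p).toNat (dec p)) =
      (B.map fun p => Finsupp.single p (m p)).sum := by
    intro B
    induction B with
    | nil => rfl
    | cons p B ih =>
      rw [List.flatMap_cons, msum_append, ih, List.map_cons, List.sum_cons]
      congr 1
      by_cases h : m p = 0
      · simp [h, msum]
      · obtain ⟨h1, h2, h3, h4, h5⟩ := hm p.1 p.2 h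
        rw [Prod.mk.eta] at h5
        rw [msum, List.map_replicate, List.sum_replicate, enc_dec h1 h2 h4, Finsupp.smul_single]
        congr 1
        simp [h5.le]
  rw [mlist, h1, ← List.sum_toFinset _ (box_nodup _)]
  conv_rhs => rw [← Finsupp.sum_single m]
  symm
  refine Finset.sum_subset ?_ ?_
  · intro p hp
    have hb := Finset.le_sup (f := fun p : ℤ × ℤ => max p.1.natAbs p.2.natAbs) hp
    rw [List.mem_toFinset]
    exact mem_box ((le_max_left _ _).trans hb) ((le_max_right _ _).trans hb)
  · intro p _ hp
    rw [Finsupp.notMem_support_iff.1 hp, Finsupp.single_zero]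

lemma msum_enc (L : List (ℤ × ℕ)) (s : ℤ × ℕ) : msum L (enc s) = L.count s := by
  induction L with
  | nil => rfl
  | cons u L ih =>
    rw [List.count_cons, ← List.singleton_append, msum_append, Finsupp.add_apply, ih, add_comm]
    push_cast
    congr 1
    simp [msum, Finsupp.single_apply, enc_injective.eq_iff]

lemma isTheta_msum {L : List (ℤ × ℕ)} (hL : ∀ s ∈ L, IsTh s) : IsTheta (msum L) := by
  intro i j h
  obtain ⟨s, hs, hsij⟩ : ∃ s ∈ L, enc s = (i, j) := by
    by_contra! hc
    refine h ?_
    clear h hL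
    induction L with
    | nil => rfl
    | cons u L ih =>
      rw [← List.singleton_append, msum_append, Finsupp.add_apply, ih fun s hs => hc s (by simp [hs])]
      simp [msum, hc u (by simp)]
  have hc := msum_enc L s
  have hpos : 0 < L.count s := List.count_pos_iff.2 hs
  rw [hsij] at hc
  have hth := hL s hs
  simp only [enc, Prod.mk.injEq, IsTh] at hsij hth
  obtain ⟨rfl, rfl⟩ := hsij
  exact ⟨⟨_, rfl⟩, ⟨_, rfl⟩, by omega, by omega, by omega⟩

lemma mlist_msum {L : List (ℤ × ℕ)} (hs : L.Pairwise pge) (hL : ∀ s ∈ L, IsTh s) :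
    mlist (msum L) = L := by
  have hp : (mlist (msum L)).Perm L := by
    rw [List.perm_iff_count]
    intro s
    have := congrArg (fun m : MS => m (enc s)) (msum_mlist (isTheta_msum hL))
    simp only [msum_enc] at this
    exact_mod_cast this
  exact hp.eq_of_pairwise (fun _ _ _ _ => pge_antisymm) (pairwise_mlist (isTheta_msum hL)) hs

end Multisegments

section Basis

lemma smul_zero_Vt (a : K) : a • (0 : Vt) = 0 := smul_zero (M := K) (A := Vt) a

lemma mul_smul_Vt (a b : K) (v : Vt) : (a * b) • v = a • b • v := mul_smul a b v

lemma zero_smul_Vt (v : Vt) : (0 : K) • v = 0 := zero_smul K v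

lemma add_smul_Vt (a b : K) (v : Vt) : (a + b) • v = a • v + b • v := add_smul a b v

lemma sum_smul_Vt {ι : Type*} (S : Finset ι) (f : ι → K) (v : Vt) :
    (∑ i ∈ S, f i) • v = ∑ i ∈ S, f i • v := by
  induction S using Finset.induction_on with
  | empty => exact zero_smul_Vt v
  | insert i S hi ih => rw [Finset.sum_insert hi, Finset.sum_insert hi, add_smul_Vt, ih]

lemma smul_comm_Vt (c : K) (x : U) (v : Vt) : x • c • v = c • x • v := smul_comm x c v

lemma smul_phi (x : U) : x • phi = (Submodule.Quotient.mk x : Vt) := by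
  rw [phi, ← Submodule.Quotient.mk_smul, smul_eq_mul, mul_one]

lemma smul_phi_eq_zero {x : U} (hx : x ∈ Jideal) : x • phi = 0 := by
  rw [smul_phi, Submodule.Quotient.mk_eq_zero]; exact hx

lemma ee_phi (k : ℤ) : ee k • phi = 0 := smul_phi_eq_zero (ee_mem k)

lemma tt_phi (k : ℤ) : tt k • phi = phi := by
  have := smul_phi_eq_zero (tt_sub_one_mem k)
  rwa [sub_smul, one_smul, sub_eq_zero] at this

lemma exists_Ptheta {m : MS} (hm : IsTheta m) :
    ∃ c : K, c ≠ 0 ∧ Ptheta m • phi = c • prd (mlist m) • phi := by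
  obtain ⟨c, hc, h⟩ := exists_PthetaProd hm
  exact ⟨c, hc, by rw [Ptheta, if_pos hm, h, smul_assoc]⟩

lemma mlist_injOn (S : Finset {m : MS // IsTheta m}) :
    Set.InjOn (fun m : {m : MS // IsTheta m} => mlist m) S := by
  intro m _ m' _ h
  exact Subtype.ext (by rw [← msum_mlist m.2, ← msum_mlist m'.2]; exact congrArg msum h)

lemma sum_ne_zero {ι : Type*} (S : Finset ι) (L : ι → List (ℤ × ℕ)) (c : ι → K)
    (hs : ∀ i ∈ S, (L i).Pairwise pge) (hth : ∀ i ∈ S, ∀ s ∈ L i, IsTh s) (hc : ∀ i ∈ S, c i ≠ 0)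
    (hinj : Set.InjOn L S) (hS : S.Nonempty) : ∑ i ∈ S, c i • prd (L i) • phi ≠ 0 := by
  intro h
  obtain ⟨x, d, hd, hx⟩ := exists_smul_eq_smul ee_phi tt_phi S L c hs hth hc hinj hS
  rw [h, smul_zero] at hx
  exact smul_ne_zero hd phi_ne_zero hx.symm

lemma linearIndependent_Ptheta :
    LinearIndependent K (fun m : {m : MS // IsTheta m} => Ptheta (m : MS) • phi) := by
  rw [linearIndependent_iff]
  intro c hc
  by_contra h
  choose d hd hP using fun m : {m : MS // IsTheta m} => exists_Ptheta m.2
  refine sum_ne_zero c.support (fun m => mlist m) (fun m => c m * d m)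
    (fun m _ => pairwise_mlist m.2) (fun m _ => isTh_mlist m.2)
    (fun m hm => mul_ne_zero (Finsupp.mem_support_iff.1 hm) (hd m)) (mlist_injOn _)
    (Finsupp.support_nonempty_iff.2 h) ?_
  rw [← hc, Finsupp.linearCombination_apply, Finsupp.sum]
  exact Finset.sum_congr rfl fun m _ => by simp only [hP, mul_smul_Vt]

lemma span_Ptheta :
    Submodule.span K (Set.range (fun m : {m : MS // IsTheta m} => Ptheta (m : MS) • phi)) = ⊤ := by
  rw [eq_top_iff]
  rintro u -
  obtain ⟨x, rfl⟩ := Submodule.Quotient.mk_surjective _ u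
  rw [← smul_phi]
  obtain ⟨y, hy, z, hz, rfl⟩ := Submodule.mem_sup.1
    (show x ∈ pbwK by rw [pbwK_eq_top]; trivial)
  rw [add_smul, smul_phi_eq_zero hz, add_zero]
  induction hy using Submodule.span_induction with
  | mem y hy =>
    obtain ⟨L, h1, h2, rfl⟩ := hy
    obtain ⟨c, hc, h⟩ := exists_Ptheta (isTheta_msum h2)
    rw [mlist_msum h1 h2] at h
    rw [← inv_smul_smul₀ hc (prd L • phi), ← h]
    exact Submodule.smul_mem _ _ (Submodule.subset_span ⟨⟨msum L, isTheta_msum h2⟩, rfl⟩)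
  | zero => rw [zero_smul]; exact Submodule.zero_mem _
  | add y y' _ _ h h' => rw [add_smul]; exact Submodule.add_mem _ h h'
  | smul c y _ h => rw [smul_assoc]; exact Submodule.smul_mem _ _ h

lemma exists_sum_eq (u : Vt) : ∃ (S : Finset {m : MS // IsTheta m}) (c : {m : MS // IsTheta m} → K),
    (∀ m ∈ S, c m ≠ 0) ∧ u = ∑ m ∈ S, c m • prd (mlist m) • phi := by
  have hu : u ∈ Submodule.span K
      (Set.range (fun m : {m : MS // IsTheta m} => Ptheta (m : MS) • phi)) := by
    rw [span_Ptheta]; trivial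
  obtain ⟨c, rfl⟩ := Finsupp.mem_span_range_iff_exists_finsupp.1 hu
  choose d hd hP using fun m : {m : MS // IsTheta m} => exists_Ptheta m.2
  refine ⟨c.support, fun m => c m * d m,
    fun m hm => mul_ne_zero (Finsupp.mem_support_iff.1 hm) (hd m), ?_⟩
  exact Finset.sum_congr rfl fun m _ => by simp only [hP, mul_smul_Vt]

lemma isSimpleModule_Vt : IsSimpleModule U Vt := by
  rw [isSimpleModule_iff_toSpanSingleton_surjective]
  refine ⟨⟨phi, 0, phi_ne_zero⟩, fun u hu w => ?_⟩
  obtain ⟨S, c, hc, rfl⟩ := exists_sum_eq u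
  have hS : S.Nonempty := by
    by_contra h
    rw [Finset.not_nonempty_iff_eq_empty] at h
    exact hu (by rw [h, Finset.sum_empty])
  obtain ⟨x, d, hd, hx⟩ := exists_smul_eq_smul ee_phi tt_phi S (fun m => mlist m) c
    (fun m _ => pairwise_mlist m.2) (fun m _ => isTh_mlist m.2) hc (mlist_injOn _) hS
  obtain ⟨y, rfl⟩ := Submodule.Quotient.mk_surjective _ w
  refine ⟨(d⁻¹ • y) * x, ?_⟩
  rw [LinearMap.toSpanSingleton_apply, mul_smul, hx, smul_assoc, smul_comm y d phi,
    inv_smul_smul₀ hd, smul_phi]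

lemma singular_vectors :
    {u : Vt | ∀ i : ℤ, Odd i → Ee i • u = 0} = {u : Vt | ∃ c : K, u = c • phi} := by
  ext u
  constructor
  · intro hu
    obtain ⟨S, c, hc, rfl⟩ := exists_sum_eq u
    by_cases hne : ∃ m ∈ S, mlist m.1 ≠ []
    · obtain ⟨a, n, S', L', c', h1, h2, h3, h4, h5, -, h7⟩ :=
        exists_Ech_reduction ee_phi tt_phi S (fun m => mlist m) c
        (fun m _ => pairwise_mlist m.2) (fun m _ => isTh_mlist m.2) hc (mlist_injOn _) hne
      refine absurd ?_ (sum_ne_zero S' L' c' h1 h2 h3 h4 h5)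
      rw [← h7, Ech, mul_smul, ← Ee_odd, hu _ ⟨a, rfl⟩, smul_zero]
    · push Not at hne
      refine ⟨∑ m ∈ S, c m, ?_⟩
      rw [sum_smul_Vt]
      exact Finset.sum_congr rfl fun m hm => by rw [hne m hm]; simp [prd]
  · rintro ⟨c, rfl⟩ i ⟨a, rfl⟩
    rw [Ee_odd, smul_comm_Vt, ee_phi, smul_zero_Vt]

end Basis

end BTheta

/-- Theorem 4.15 (i) and Proposition 2.11 for `λ = 0`: the PBW vectors `P_θ(m)φ̃`
(`m ∈ M_θ`) form a `K`-basis of `Ṽ_θ(0)`; moreover `Ṽ_θ(0)` is an irreducible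
`B_θ(gl_∞)`-module (hence `Ṽ_θ(0) ≅ V_θ(0)`), and the space of vectors killed by all
the `E_i` is exactly `Kφ̃`. -/
theorem PBW_basis_and_irreducibility :
    (LinearIndependent K (fun m : {m : MS // IsTheta m} => Ptheta (m : MS) • phi) ∧
      Submodule.span K (Set.range (fun m : {m : MS // IsTheta m} =>
        Ptheta (m : MS) • phi)) = ⊤) ∧
    IsSimpleModule U Vt ∧
    {u : Vt | ∀ i : ℤ, Odd i → Ee i • u = 0} = {u : Vt | ∃ c : K, u = c • phi} := by
  exact ⟨⟨BTheta.linearIndependent_Ptheta, BTheta.span_Ptheta⟩, BTheta.isSimpleModule_Vt,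
    BTheta.singular_vectors⟩

end
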